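/- arXiv:math/0412322 — 3 statements merged into one kernel-verified Lean document; each statement's English description precedes it below -/
import Mathlib

section
/- Let α ∈ (0, 1/2] and x > 0, and let p : (0,∞) → [0,∞) be a continuous function satisfying ∫₀^∞ e^{−qt} p(t) dt = exp(−x q^α) for all q > 0 (i.e., p is the density at time x of the stable subordinator of index α). Then p(t) ≤ (α / Γ(1−α)) · x · t^{−(1+α)} for every t > 0. -/
open MeasureTheory Real Set

noncomputable section

/-- A Bernstein function: infinitely differentiable on `(0,∞)`, nonnegative there,
and `(-1)^(n-1) f^(n)(q) ≥ 0` for all `n ≥ 1` and `q > 0`. -/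
def IsBernstein (f : ℝ → ℝ) : Prop :=
  ContDiffOn ℝ (⊤ : ℕ∞) f (Ioi 0) ∧
  (∀ q > (0:ℝ), 0 ≤ f q) ∧
  ∀ n : ℕ, 1 ≤ n → ∀ q > (0:ℝ), 0 ≤ (-1 : ℝ) ^ (n - 1) * iteratedDerivWithin n f (Ioi 0) q

/-- A completely monotone function: infinitely differentiable on `(0,∞)` with
`(-1)^n f^(n)(q) ≥ 0` for all `n ≥ 0` and `q > 0`. -/
def IsCompletelyMonotone (f : ℝ → ℝ) : Prop :=
  ContDiffOn ℝ (⊤ : ℕ∞) f (Ioi 0) ∧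
  ∀ n : ℕ, ∀ q > (0:ℝ), 0 ≤ (-1 : ℝ) ^ n * iteratedDerivWithin n f (Ioi 0) q

/-- A (sub)critical branching mechanism:
`Ψ q = a q + b q² + ∫_{(0,∞)} (e^(-qx) - 1 + qx) Pi(dx)` with `a, b ≥ 0` and
`∫ min(x, x²) Pi(dx) < ∞` (`Pi` a measure carried by `(0,∞)`). -/
def IsBranchingMechanism (Ψ : ℝ → ℝ) : Prop :=
  ∃ (a b : ℝ) (Pi : Measure ℝ), 0 ≤ a ∧ 0 ≤ b ∧ Pi (Iic 0) = 0 ∧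
    (∫⁻ x, ENNReal.ofReal (min x (x ^ 2)) ∂Pi) < ⊤ ∧
    ∀ q > (0:ℝ), Ψ q = a * q + b * q ^ 2 + ∫ x, (Real.exp (-q * x) - 1 + q * x) ∂Pi

open scoped ENNReal Topology
open Filter ProbabilityTheory

lemma integrable_exp_of_lap {μ : Measure ℝ} {q : ℝ}
    (hμ : ∫⁻ t, ENNReal.ofReal (Real.exp (-q * t)) ∂μ ≠ ⊤) :
    Integrable (fun t => Real.exp (-q * t)) μ := by
  refine ⟨by fun_prop, ?_⟩
  rw [hasFiniteIntegral_iff_ofReal (Eventually.of_forall fun t => (Real.exp_pos _).le)]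
  exact lt_top_iff_ne_top.2 hμ

lemma neg_mem_interior {μ : Measure ℝ}
    (hμ : ∀ q > (0:ℝ), ∫⁻ t, ENNReal.ofReal (Real.exp (-q * t)) ∂μ ≠ ⊤) {s : ℝ} (hs : s < 0) :
    s ∈ interior (integrableExpSet id μ) := by
  refine mem_interior.2 ⟨Iio 0, ?_, isOpen_Iio, hs⟩
  intro r hr
  have := integrable_exp_of_lap (hμ (-r) (by simpa using hr))
  simpa [integrableExpSet] using this

lemma mgf_eq_of_lap {μ : Measure ℝ} {q : ℝ} :
    mgf id μ (-q) = (∫⁻ t, ENNReal.ofReal (Real.exp (-q * t)) ∂μ).toReal := by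
  rw [mgf, integral_eq_lintegral_of_nonneg_ae (Eventually.of_forall fun t => (Real.exp_pos _).le)
    (by fun_prop)]
  simp

lemma tilt_finite {μ : Measure ℝ}
    (hμ : ∀ q > (0:ℝ), ∫⁻ t, ENNReal.ofReal (Real.exp (-q * t)) ∂μ ≠ ⊤) :
    IsFiniteMeasure (μ.withDensity (fun t => ENNReal.ofReal (Real.exp (-t)))) := by
  apply isFiniteMeasure_withDensity
  simpa using hμ 1 one_pos

lemma charFun_tilt {μ : Measure ℝ} (w : ℝ) :
    charFun (μ.withDensity (fun t => ENNReal.ofReal (Real.exp (-t)))) w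
      = complexMGF id μ (-1 + w * Complex.I) := by
  rw [charFun_apply_real, integral_withDensity_eq_integral_toReal_smul (by fun_prop) (by simp),
    complexMGF]
  congr 1
  ext t
  rw [ENNReal.toReal_ofReal (Real.exp_pos _).le, Complex.real_smul, Complex.ofReal_exp,
    ← Complex.exp_add]
  congr 1
  simp
  ring

lemma laplace_unique {μ ν : Measure ℝ}
    (hμ : ∀ q > (0:ℝ), ∫⁻ t, ENNReal.ofReal (Real.exp (-q * t)) ∂μ ≠ ⊤)
    (h : ∀ q > (0:ℝ), ∫⁻ t, ENNReal.ofReal (Real.exp (-q * t)) ∂μ =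
      ∫⁻ t, ENNReal.ofReal (Real.exp (-q * t)) ∂ν) : μ = ν := by
  have hν : ∀ q > (0:ℝ), ∫⁻ t, ENNReal.ofReal (Real.exp (-q * t)) ∂ν ≠ ⊤ :=
    fun q hq => h q hq ▸ hμ q hq
  have key : Set.EqOn (complexMGF id μ) (complexMGF id ν) {z | z.re ∈ Iio 0} := by
    have hX : AnalyticOnNhd ℂ (complexMGF id μ) {z | z.re ∈ Iio 0} :=
      analyticOnNhd_complexMGF.mono fun z hz => neg_mem_interior hμ hz
    have hY : AnalyticOnNhd ℂ (complexMGF id ν) {z | z.re ∈ Iio 0} :=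
      analyticOnNhd_complexMGF.mono fun z hz => neg_mem_interior hν hz
    refine AnalyticOnNhd.eqOn_of_preconnected_of_frequently_eq hX hY
      ((convex_Iio (0:ℝ)).linear_preimage Complex.reLm).isPreconnected
      (z₀ := ((-1 : ℝ) : ℂ)) (by simp) ?_
    have h_real : ∃ᶠ (x : ℝ) in 𝓝[≠] (-1:ℝ), complexMGF id μ x = complexMGF id ν x := by
      apply Eventually.frequently
      filter_upwards [nhdsWithin_le_nhds (Iio_mem_nhds (show (-1:ℝ) < 0 by norm_num))] with y hy
      rw [complexMGF_ofReal, complexMGF_ofReal]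
      have h1 := mgf_eq_of_lap (μ := μ) (q := -y)
      have h2 := mgf_eq_of_lap (μ := ν) (q := -y)
      rw [neg_neg] at h1 h2
      rw [h1, h2]
      have := h (-y) (by simpa using hy)
      rw [neg_neg] at this
      rw [this]
    rw [frequently_iff_seq_forall] at h_real ⊢
    obtain ⟨xs, hx_tendsto, hx_eq⟩ := h_real
    refine ⟨fun n ↦ xs n, ?_, fun n ↦ ?_⟩
    · rw [tendsto_nhdsWithin_iff] at hx_tendsto ⊢
      constructor
      · exact (Complex.continuous_ofReal.tendsto _).comp hx_tendsto.1
      · filter_upwards [hx_tendsto.2] with n hn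
        simp only [mem_compl_iff, mem_singleton_iff] at hn ⊢
        exact_mod_cast hn
    · simp [hx_eq]
  have := tilt_finite hμ
  have := tilt_finite hν
  have e : μ.withDensity (fun t => ENNReal.ofReal (Real.exp (-t)))
      = ν.withDensity (fun t => ENNReal.ofReal (Real.exp (-t))) := by
    apply Measure.ext_of_charFun
    ext w
    rw [charFun_tilt, charFun_tilt]
    exact key (by simp)
  have i (ρ : Measure ℝ) := withDensity_inv_same (μ := ρ)
    (f := fun t => ENNReal.ofReal (Real.exp (-t))) (by fun_prop)
    (Eventually.of_forall fun t => by simp [Real.exp_pos]) (Eventually.of_forall fun t => by simp)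
  rw [← i μ, e, i ν]

lemma gamma_lap {a q : ℝ} (ha : 0 < a) (hq : 0 < q) :
    ∫⁻ t in Ioi (0:ℝ), ENNReal.ofReal (t ^ (a - 1) / Real.Gamma a) *
      ENNReal.ofReal (Real.exp (-q * t)) = ENNReal.ofReal (q ^ (-a)) := by
  have h := integral_rpow_mul_exp_neg_mul_Ioi ha hq
  have hG := Real.Gamma_pos_of_pos ha
  have hint : IntegrableOn (fun t : ℝ ↦ t ^ (a - 1) * rexp (-(q * t))) (Ioi 0) :=
    .of_integral_ne_zero (by rw [h]; positivity)
  have e : q ^ (-a) = ∫ t in Ioi (0:ℝ), (t ^ (a - 1) * rexp (-(q * t))) / Real.Gamma a := by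
    rw [integral_div, h, one_div, Real.inv_rpow hq.le, Real.rpow_neg hq.le]
    field_simp
  rw [e, ofReal_integral_eq_lintegral_ofReal (hint.div_const _)]
  · refine setLIntegral_congr_fun measurableSet_Ioi fun t ht => ?_
    have ht : 0 < t := ht
    rw [← ENNReal.ofReal_mul (by positivity)]
    congr 1
    rw [neg_mul]; ring
  · filter_upwards [ae_restrict_mem measurableSet_Ioi] with t ht
    have ht : 0 < t := ht
    simp only [Pi.zero_apply]
    positivity

lemma exists_kernel {b : ℝ} (hb : 0 ≤ b) : ∃ κ : Measure ℝ, SFinite κ ∧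
    ∀ q > (0:ℝ), ∫⁻ t, ENNReal.ofReal (Real.exp (-q * t)) ∂κ = ENNReal.ofReal (q ^ (-b)) := by
  rcases hb.eq_or_lt with rfl | hb
  · refine ⟨Measure.dirac 0, inferInstance, fun q hq => ?_⟩
    simp
  · refine ⟨(volume.restrict (Ioi 0)).withDensity
      (fun t => ENNReal.ofReal (t ^ (b - 1) / Real.Gamma b)), inferInstance, fun q hq => ?_⟩
    rw [lintegral_withDensity_eq_lintegral_mul _ (by fun_prop) (by fun_prop)]
    exact gamma_lap hb hq

lemma moment_lap {μ : Measure ℝ} {α x : ℝ} (hpos : ∀ᵐ t ∂μ, 0 < t)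
    (hμ : ∀ q > (0:ℝ), ∫⁻ t, ENNReal.ofReal (Real.exp (-q * t)) ∂μ
      = ENNReal.ofReal (Real.exp (-x * q ^ α))) {q : ℝ} (hq : 0 < q) :
    ∫⁻ t, ENNReal.ofReal (Real.exp (-q * t)) ∂(μ.withDensity fun t => ENNReal.ofReal t)
      = ENNReal.ofReal (α * x * q ^ (α - 1) * Real.exp (-x * q ^ α)) := by
  have hfin : ∀ q > (0:ℝ), ∫⁻ t, ENNReal.ofReal (Real.exp (-q * t)) ∂μ ≠ ⊤ :=
    fun q hq => by rw [hμ q hq]; simp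
  have hmem := neg_mem_interior hfin (neg_lt_zero.2 hq)
  have h1 := hasDerivAt_mgf hmem
  have h2 : HasDerivAt (mgf id μ) (α * x * q ^ (α - 1) * Real.exp (-x * q ^ α)) (-q) := by
    have h3 : HasDerivAt (fun s : ℝ => Real.exp (-x * (-s) ^ α))
        (Real.exp (-x * (- -q) ^ α) * (-x * ((-1) * α * (- -q) ^ (α - 1)))) (-q) :=
      ((HasDerivAt.rpow_const (hasDerivAt_neg (-q)) (Or.inl (by simpa using hq.ne'))).const_mul
        (-x)).exp
    have h4 : mgf id μ =ᶠ[𝓝 (-q)] fun s : ℝ => Real.exp (-x * (-s) ^ α) := by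
      filter_upwards [Iio_mem_nhds (neg_lt_zero.2 hq)] with s hs
      have := mgf_eq_of_lap (μ := μ) (q := -s)
      rw [hμ (-s) (by simpa using hs), neg_neg, ENNReal.toReal_ofReal (Real.exp_pos _).le] at this
      exact this
    refine (h3.congr_of_eventuallyEq h4).congr_deriv ?_
    rw [neg_neg]; ring
  rw [← h1.unique h2, lintegral_withDensity_eq_lintegral_mul _ (by fun_prop) (by fun_prop),
    ofReal_integral_eq_lintegral_ofReal]
  · refine lintegral_congr_ae ?_
    filter_upwards [hpos] with t ht
    simp only [Pi.mul_apply, id]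
    rw [← ENNReal.ofReal_mul ht.le]
  · simpa using integrable_pow_mul_exp_of_mem_interior_integrableExpSet hmem 1
  · filter_upwards [hpos] with t ht
    simp only [Pi.zero_apply, id]
    positivity

lemma conv_lap {μ κ : Measure ℝ} [SFinite μ] [SFinite κ] {α x : ℝ} (hα : 0 < α) (hx : 0 < x)
    (hμ : ∀ q > (0:ℝ), ∫⁻ t, ENNReal.ofReal (Real.exp (-q * t)) ∂μ
      = ENNReal.ofReal (Real.exp (-x * q ^ α)))
    (hκ : ∀ q > (0:ℝ), ∫⁻ t, ENNReal.ofReal (Real.exp (-q * t)) ∂κ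
      = ENNReal.ofReal (q ^ (2 * α - 1))) {q : ℝ} (hq : 0 < q) :
    ∫⁻ t, ENNReal.ofReal (Real.exp (-q * t)) ∂((κ.prod ((volume.restrict (Ioc 0 x)).prod μ)).map
      (fun w : ℝ × ℝ × ℝ => w.1 + (w.2.1 / x) ^ (1 / α) * w.2.2))
      = ENNReal.ofReal (q ^ (α - 1) * (1 - Real.exp (-x * q ^ α))) := by
  have hc : 0 < q ^ α := by positivity
  have hint : ∫ y in Ioc 0 x, Real.exp (-(q ^ α) * y) =
      (1 - Real.exp (-x * q ^ α)) / q ^ α := by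
    rw [← intervalIntegral.integral_of_le hx.le, intervalIntegral.integral_comp_mul_left
      (fun y => Real.exp y) (neg_ne_zero.2 hc.ne'), integral_exp, smul_eq_mul, mul_zero,
      Real.exp_zero, show -x * q ^ α = -(q ^ α) * x by ring]
    field_simp
    ring
  have hinner : ∫⁻ v : ℝ × ℝ, ENNReal.ofReal (Real.exp (-q * ((v.1 / x) ^ (1 / α) * v.2)))
      ∂((volume.restrict (Ioc 0 x)).prod μ)
      = ENNReal.ofReal ((1 - Real.exp (-x * q ^ α)) / q ^ α) := by
    rw [lintegral_prod _ (by fun_prop), ← hint, ofReal_integral_eq_lintegral_ofReal]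
    · refine setLIntegral_congr_fun measurableSet_Ioc fun y hy => ?_
      have hy0 : 0 < y := hy.1
      have hyx : 0 < (y / x) ^ (1 / α) := by positivity
      have := hμ (q * (y / x) ^ (1 / α)) (by positivity)
      simp only
      rw [Real.mul_rpow hq.le hyx.le, ← Real.rpow_mul (by positivity), one_div,
        inv_mul_cancel₀ hα.ne', Real.rpow_one] at this
      calc _ = _ := by
            refine lintegral_congr fun t => ?_
            congr 2
            ring
        _ = _ := this
        _ = _ := by
            congr 2
            field_simp
    · exact (Continuous.integrableOn_Ioc (by fun_prop))
    · exact Eventually.of_forall fun t => (Real.exp_pos _).le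
  rw [lintegral_map (by fun_prop) (by fun_prop)]
  have e (w : ℝ × ℝ × ℝ) :
      ENNReal.ofReal (Real.exp (-q * (w.1 + (w.2.1 / x) ^ (1 / α) * w.2.2))) =
      ENNReal.ofReal (Real.exp (-q * w.1)) *
        ENNReal.ofReal (Real.exp (-q * ((w.2.1 / x) ^ (1 / α) * w.2.2))) := by
    rw [← ENNReal.ofReal_mul (Real.exp_pos _).le, ← Real.exp_add]
    congr 2; ring
  simp_rw [e]
  rw [lintegral_prod_mul (f := fun s : ℝ => ENNReal.ofReal (Real.exp (-q * s)))
    (g := fun v : ℝ × ℝ => ENNReal.ofReal (Real.exp (-q * ((v.1 / x) ^ (1 / α) * v.2))))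
    (by fun_prop) (by fun_prop), hinner, hκ q hq, ← ENNReal.ofReal_mul (by positivity)]
  congr 1
  have : q ^ (2 * α - 1) = q ^ (α - 1) * q ^ α := by
    rw [← Real.rpow_add hq]; congr 1; ring
  rw [this]
  field_simp

/-- For `α ∈ (0,1/2]` and `x > 0`, the density `p` of the stable
subordinator of index `α` at time `x` (characterized by its Laplace transform)
satisfies `p(t) ≤ (α/Γ(1-α)) x t^(-(1+α))` for all `t > 0`. -/
theorem stable_density_bound
    (α x : ℝ) (hα : α ∈ Set.Ioc (0:ℝ) (1/2)) (hx : 0 < x)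
    (p : ℝ → ℝ)
    (hp_cont : ContinuousOn p (Ioi 0))
    (hp_nonneg : ∀ t > (0:ℝ), 0 ≤ p t)
    (hp_lap : ∀ q > (0:ℝ),
      (∫ t in Ioi (0:ℝ), Real.exp (-q * t) * p t) = Real.exp (-x * q ^ α)) :
    ∀ t > (0:ℝ), p t ≤ α / Real.Gamma (1 - α) * x * t ^ (-(1 + α)) := by
  obtain ⟨hα0, hα1⟩ := hα
  have hG : 0 < Real.Gamma (1 - α) := Real.Gamma_pos_of_pos (by linarith)
  have hpm : Measurable ((Ioi (0:ℝ)).indicator p) := by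
    classical
    rw [← Set.piecewise_eq_indicator]
    exact hp_cont.measurable_piecewise continuousOn_const measurableSet_Ioi
  set P := (Ioi (0:ℝ)).indicator p with hP
  have hPp : ∀ t > (0:ℝ), P t = p t := fun t ht => indicator_of_mem (s := Ioi (0:ℝ)) ht p
  set m := (volume : Measure ℝ).restrict (Ioi 0) with hm
  set μ := m.withDensity (fun t => ENNReal.ofReal (P t)) with hμd
  have hpos : ∀ᵐ t ∂μ, 0 < t :=
    (withDensity_absolutelyContinuous _ _) (ae_restrict_mem measurableSet_Ioi)
  have hμ : ∀ q > (0:ℝ), ∫⁻ t, ENNReal.ofReal (Real.exp (-q * t)) ∂μ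
      = ENNReal.ofReal (Real.exp (-x * q ^ α)) := by
    intro q hq
    rw [lintegral_withDensity_eq_lintegral_mul _ (by fun_prop) (by fun_prop), ← hp_lap q hq,
      ofReal_integral_eq_lintegral_ofReal]
    · refine setLIntegral_congr_fun measurableSet_Ioi fun t ht => ?_
      simp only [Pi.mul_apply]
      rw [hPp t ht, mul_comm, ENNReal.ofReal_mul (Real.exp_pos _).le]
    · exact .of_integral_ne_zero (by rw [hp_lap q hq]; positivity)
    · filter_upwards [ae_restrict_mem measurableSet_Ioi] with t ht
      exact mul_nonneg (Real.exp_pos _).le (hp_nonneg t ht)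
  obtain ⟨κ, hκs, hκ⟩ := exists_kernel (b := 1 - 2 * α) (by linarith)
  have hκ' : ∀ q > (0:ℝ), ∫⁻ t, ENNReal.ofReal (Real.exp (-q * t)) ∂κ
      = ENNReal.ofReal (q ^ (2 * α - 1)) := by
    intro q hq; rw [hκ q hq]; congr 2; ring
  set D := ((κ.prod ((volume.restrict (Ioc 0 x)).prod μ)).map
      (fun w : ℝ × ℝ × ℝ => w.1 + (w.2.1 / x) ^ (1 / α) * w.2.2))
  set A := μ.withDensity fun t => ENNReal.ofReal t with hA
  set B := m.withDensity fun t => ENNReal.ofReal (α * x) *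
    ENNReal.ofReal (t ^ ((1 - α) - 1) / Real.Gamma (1 - α)) with hB
  have hBl : ∀ q > (0:ℝ), ∫⁻ t, ENNReal.ofReal (Real.exp (-q * t)) ∂B
      = ENNReal.ofReal (α * x * q ^ (α - 1)) := by
    intro q hq
    rw [lintegral_withDensity_eq_lintegral_mul _ (by fun_prop) (by fun_prop)]
    simp only [Pi.mul_apply, mul_assoc (ENNReal.ofReal (α * x))]
    rw [lintegral_const_mul _ (by fun_prop), gamma_lap (by linarith) hq,
      ← ENNReal.ofReal_mul (by positivity)]
    congr 3; ring
  have hBA : B = A + ENNReal.ofReal (α * x) • D := by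
    apply laplace_unique
    · intro q hq; rw [hBl q hq]; simp
    · intro q hq
      have hE : Real.exp (-x * q ^ α) ≤ 1 := by
        rw [Real.exp_le_one_iff]
        have : 0 < x * q ^ α := by positivity
        linarith
      rw [hBl q hq, lintegral_add_measure, lintegral_smul_measure, moment_lap hpos hμ hq,
        conv_lap hα0 hx hμ hκ' hq, smul_eq_mul, ← ENNReal.ofReal_mul (by positivity),
        ← ENNReal.ofReal_add (by positivity)
          (mul_nonneg (by positivity) (mul_nonneg (by positivity) (by linarith)))]
      congr 1; ring
  have hle : A ≤ B := by rw [hBA]; exact Measure.le_add_right le_rfl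
  have hA2 : A = m.withDensity (fun t => ENNReal.ofReal (P t) * ENNReal.ofReal t) := by
    rw [hA, hμd, ← withDensity_mul _ (by fun_prop) (by fun_prop)]
    rfl
  have hae : (fun t => ENNReal.ofReal (P t) * ENNReal.ofReal t) ≤ᵐ[m]
      fun t => ENNReal.ofReal (α * x) *
        ENNReal.ofReal (t ^ ((1 - α) - 1) / Real.Gamma (1 - α)) := by
    refine ae_le_of_forall_setLIntegral_le_of_sigmaFinite (by fun_prop) fun s hs _ => ?_
    rw [← withDensity_apply _ hs, ← withDensity_apply _ hs, ← hA2]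
    exact hle s
  set g : ℝ → ℝ := fun t => α / Real.Gamma (1 - α) * x * t ^ (-(1 + α)) with hg
  have hgc : ContinuousOn g (Ioi 0) := by
    refine continuousOn_const.mul (continuousOn_id.rpow_const fun t ht => Or.inl ?_)
    exact (ne_of_gt ht)
  have hae2 : (fun t => max (p t) (g t)) =ᵐ[m] g := by
    filter_upwards [hae, ae_restrict_mem measurableSet_Ioi] with t ht ht0
    have ht0 : 0 < t := ht0
    apply max_eq_right
    rw [hPp t ht0, ← ENNReal.ofReal_mul (hp_nonneg t ht0), ← ENNReal.ofReal_mul (by positivity),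
      ENNReal.ofReal_le_ofReal_iff (by positivity)] at ht
    have e : g t = (α * x * (t ^ ((1 - α) - 1) / Real.Gamma (1 - α))) / t := by
      have : t ^ (-(1 + α)) = t ^ ((1 - α) - 1) / t := by
        rw [← Real.rpow_sub_one ht0.ne']; congr 1; ring
      simp only [hg]
      rw [this]; ring
    rw [e, le_div_iff₀ ht0]
    exact ht
  have hfin := Measure.eqOn_open_of_ae_eq hae2 isOpen_Ioi (hp_cont.sup hgc) hgc
  intro t ht
  exact max_eq_right_iff.1 (hfin ht)
end
end

section
/- Let α ∈ (0, 1/2) and let p : (0,∞) × (0,∞) → [0,∞) be jointly measurable, continuous in its second argument, and satisfy ∫₀^∞ e^{−qt} p(x,t) dt = exp(−x q^α) for all x, q > 0. Then for all x, t > 0: (α/Γ(1−α)) t^{−α} − (t/x) p(x,t) = (α/Γ(1−2α)) ∫₀^x ∫₀^t s^{−2α} p(y, t−s) ds dy. In particular the left-hand side is nonnegative. -/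
open MeasureTheory Real Set

noncomputable section

/-- The Laplace kernel as an extended nonnegative real. -/
def ek (q t : ℝ) : ENNReal := ENNReal.ofReal (Real.exp (-q * t))

lemma measurable_ek (q : ℝ) : Measurable (ek q) := by
  unfold ek; fun_prop

lemma ek_ne_top (q t : ℝ) : ek q t ≠ ⊤ := ENNReal.ofReal_ne_top
lemma ek_ne_zero (q t : ℝ) : ek q t ≠ 0 := by
  unfold ek
  simp [Real.exp_pos]

lemma ek_mul_exp (q s t : ℝ) : ENNReal.ofReal (Real.exp (s * t)) * ek q t = ek (q - s) t := by
  unfold ek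
  rw [← ENNReal.ofReal_mul (Real.exp_pos _).le, ← Real.exp_add]
  congr 2; ring

lemma ek_split (q s t : ℝ) : ek q t = ek q s * ek q (t - s) := by
  unfold ek
  rw [← ENNReal.ofReal_mul (Real.exp_pos _).le, ← Real.exp_add]
  congr 2; ring

lemma lintegral_exp_wd (f : ℝ → ENNReal) (hf : Measurable f) (s : ℝ) :
    ∫⁻ t, ENNReal.ofReal (Real.exp (s * t))
      ∂((volume.restrict (Ioi (0:ℝ))).withDensity (fun t => ek 1 t * f t)) =
    ∫⁻ t in Ioi (0:ℝ), ek (1 - s) t * f t := by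
  have hm : Measurable (fun t => ek 1 t * f t) := (measurable_ek 1).mul hf
  rw [lintegral_withDensity_eq_lintegral_mul _ hm (by fun_prop)]
  refine lintegral_congr fun t => ?_
  simp only [Pi.mul_apply]
  rw [← ek_mul_exp 1 s t]; ring

lemma laplace_unique_s3 (f g : ℝ → ENNReal) (hf : Measurable f) (hg : Measurable g)
    (hfin : ∀ q > (0:ℝ), ∫⁻ t in Ioi (0:ℝ), ek q t * f t ≠ ⊤)
    (heq : ∀ q > (0:ℝ), ∫⁻ t in Ioi (0:ℝ), ek q t * f t = ∫⁻ t in Ioi (0:ℝ), ek q t * g t) :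
    f =ᵐ[volume.restrict (Ioi (0:ℝ))] g := by
  set μ := (volume.restrict (Ioi (0:ℝ))).withDensity (fun t => ek 1 t * f t) with hμ
  set ν := (volume.restrict (Ioi (0:ℝ))).withDensity (fun t => ek 1 t * g t) with hν
  have hmg : ∀ s < (1:ℝ), ProbabilityTheory.mgf id μ s = ProbabilityTheory.mgf id ν s := by
    intro s hs
    unfold ProbabilityTheory.mgf
    rw [integral_eq_lintegral_of_nonneg_ae (Filter.Eventually.of_forall fun _ => (Real.exp_pos _).le)
      (by simp only [id]; fun_prop),
      integral_eq_lintegral_of_nonneg_ae (Filter.Eventually.of_forall fun _ => (Real.exp_pos _).le)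
      (by simp only [id]; fun_prop)]
    simp only [id]
    rw [lintegral_exp_wd f hf, lintegral_exp_wd g hg, heq _ (by linarith)]
  have hexp : ∀ h : ℝ → ENNReal, Measurable h →
      (∀ q > (0:ℝ), ∫⁻ t in Ioi (0:ℝ), ek q t * h t ≠ ⊤) →
      ∀ s < (1:ℝ), s ∈ interior (ProbabilityTheory.integrableExpSet id
        ((volume.restrict (Ioi (0:ℝ))).withDensity (fun t => ek 1 t * h t))) := by
    intro h hh hfin s hs
    refine interior_mono (s := Iio 1) ?_ (by rw [interior_Iio]; exact hs)
    intro s hs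
    simp only [ProbabilityTheory.integrableExpSet, id]
    refine ⟨by fun_prop, ?_⟩
    rw [hasFiniteIntegral_iff_ofReal (Filter.Eventually.of_forall fun _ => (Real.exp_pos _).le)]
    rw [lintegral_exp_wd h hh]
    exact (hfin _ (by simp only [mem_Iio] at hs; linarith)).lt_top
  have hgfin : ∀ q > (0:ℝ), ∫⁻ t in Ioi (0:ℝ), ek q t * g t ≠ ⊤ := fun q hq => heq q hq ▸ hfin q hq
  have hX := hexp f hf hfin
  have hY := hexp g hg hgfin
  rw [← hμ] at hX
  rw [← hν] at hY
  have hEq : Set.EqOn (ProbabilityTheory.complexMGF id μ) (ProbabilityTheory.complexMGF id ν)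
      {z : ℂ | z.re < 1} := by
    have aX : AnalyticOnNhd ℂ (ProbabilityTheory.complexMGF id μ) {z : ℂ | z.re < 1} :=
      ProbabilityTheory.analyticOnNhd_complexMGF.mono fun z hz => hX _ hz
    have aY : AnalyticOnNhd ℂ (ProbabilityTheory.complexMGF id ν) {z : ℂ | z.re < 1} :=
      ProbabilityTheory.analyticOnNhd_complexMGF.mono fun z hz => hY _ hz
    refine AnalyticOnNhd.eqOn_of_preconnected_of_frequently_eq aX aY
      (convex_halfSpace_re_lt 1).isPreconnected (z₀ := ((0:ℝ) : ℂ)) (by simp) ?_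
    have h_real : ∃ᶠ (x : ℝ) in nhdsWithin 0 {0}ᶜ,
        ProbabilityTheory.complexMGF id μ x = ProbabilityTheory.complexMGF id ν x := by
      refine Filter.Eventually.frequently ?_
      have : ∀ᶠ x : ℝ in nhdsWithin 0 {0}ᶜ, x < 1 :=
        mem_nhdsWithin_of_mem_nhds (Iio_mem_nhds (by norm_num))
      filter_upwards [this] with x hx
      rw [ProbabilityTheory.complexMGF_ofReal, ProbabilityTheory.complexMGF_ofReal, hmg x hx]
    rw [Filter.frequently_iff_seq_forall] at h_real ⊢
    obtain ⟨xs, hx_tendsto, hx_eq⟩ := h_real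
    refine ⟨fun n ↦ xs n, ?_, fun n ↦ ?_⟩
    · rw [tendsto_nhdsWithin_iff] at hx_tendsto ⊢
      constructor
      · rw [Filter.tendsto_ofReal_iff]
        exact hx_tendsto.1
      · simpa using hx_tendsto.2
    · simp [hx_eq]
  have fin1 : IsFiniteMeasure μ := isFiniteMeasure_withDensity (hfin 1 one_pos)
  have fin2 : IsFiniteMeasure ν := isFiniteMeasure_withDensity (hgfin 1 one_pos)
  have hmeas : μ = ν := by
    apply Measure.ext_of_charFun
    ext t
    rw [← ProbabilityTheory.complexMGF_id_mul_I, ← ProbabilityTheory.complexMGF_id_mul_I]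
    exact hEq (by simp)
  have := (withDensity_eq_iff ((measurable_ek 1).mul hf).aemeasurable
    ((measurable_ek 1).mul hg).aemeasurable (hfin 1 one_pos)).1 hmeas
  filter_upwards [this] with t ht
  exact (ENNReal.mul_right_inj (ek_ne_zero _ _) (ek_ne_top _ _)).1 ht

lemma lint_of_int (f : ℝ → ℝ) (hf : ∀ t > (0:ℝ), 0 ≤ f t) (c q : ℝ) (hc : 0 < c)
    (h : ∫ t in Ioi (0:ℝ), Real.exp (-q * t) * f t = c) :
    ∫⁻ t in Ioi (0:ℝ), ek q t * ENNReal.ofReal (f t) = ENNReal.ofReal c := by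
  have hi : Integrable (fun t => Real.exp (-q * t) * f t) (volume.restrict (Ioi (0:ℝ))) := by
    by_contra hn
    rw [integral_undef hn] at h; exact hc.ne h
  rw [← h, ofReal_integral_eq_lintegral_ofReal hi]
  · refine lintegral_congr fun t => ?_
    rw [ENNReal.ofReal_mul (Real.exp_pos _).le]; rfl
  · filter_upwards [ae_restrict_mem measurableSet_Ioi] with t ht
    exact mul_nonneg (Real.exp_pos _).le (hf t ht)

lemma lap_gamma (β q : ℝ) (hβ : β < 1) (hq : 0 < q) :
    ∫⁻ t in Ioi (0:ℝ), ek q t * ENNReal.ofReal (t ^ (-β)) =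
      ENNReal.ofReal (Real.Gamma (1 - β) * q ^ (β - 1)) := by
  refine lint_of_int (fun t => t ^ (-β)) (fun t ht => Real.rpow_nonneg ht.le _) _ _
    (mul_pos (Real.Gamma_pos_of_pos (by linarith)) (Real.rpow_pos_of_pos hq _)) ?_
  have := Real.integral_rpow_mul_exp_neg_mul_Ioi (a := 1 - β) (r := q) (by linarith) hq
  rw [one_div, Real.inv_rpow hq.le, ← Real.rpow_neg hq.le] at this
  rw [mul_comm, show β - 1 = -(1 - β) by ring, ← this]
  refine integral_congr_ae (Filter.Eventually.of_forall fun t => ?_)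
  simp only
  rw [mul_comm]; congr 2 <;> ring

lemma lap_tp (f : ℝ → ℝ) (hfm : Measurable f) (hf : ∀ t > (0:ℝ), 0 ≤ f t) (x α : ℝ)
    (hx : 0 < x) (hα : 0 < α)
    (h : ∀ q > (0:ℝ), ∫ t in Ioi (0:ℝ), Real.exp (-q * t) * f t = Real.exp (-x * q ^ α))
    (q : ℝ) (hq : 0 < q) :
    ∫⁻ t in Ioi (0:ℝ), ek q t * ENNReal.ofReal (t / x * f t) =
      ENNReal.ofReal (α * q ^ (α - 1) * Real.exp (-x * q ^ α)) := by
  refine lint_of_int (fun t => t / x * f t) (fun t ht => mul_nonneg (by positivity) (hf t ht)) _ _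
    (by positivity) ?_
  set μ := (volume.restrict (Ioi (0:ℝ))).withDensity (fun t => ENNReal.ofReal (f t)) with hμ
  have hint : ∀ g : ℝ → ℝ, ∫ t, g t ∂μ = ∫ t in Ioi (0:ℝ), f t * g t := by
    intro g
    rw [hμ, integral_withDensity_eq_integral_toReal_smul (by fun_prop)
      (Filter.Eventually.of_forall fun _ => ENNReal.ofReal_lt_top)]
    refine setIntegral_congr_fun measurableSet_Ioi fun t ht => ?_
    simp [ENNReal.toReal_ofReal (hf t ht)]
  have hm : ∀ s < (0:ℝ), ProbabilityTheory.mgf id μ s = Real.exp (-x * (-s) ^ α) := by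
    intro s hs
    unfold ProbabilityTheory.mgf
    rw [hint, ← h (-s) (by linarith)]
    refine integral_congr_ae (Filter.Eventually.of_forall fun t => ?_)
    simp [mul_comm]
  have hset : -q ∈ interior (ProbabilityTheory.integrableExpSet id μ) := by
    refine interior_mono (s := Iio 0) ?_ (by rw [interior_Iio]; simpa using hq)
    intro s hs
    simp only [ProbabilityTheory.integrableExpSet]
    by_contra hn
    have := hm s hs
    unfold ProbabilityTheory.mgf at this
    rw [integral_undef hn] at this
    exact (Real.exp_pos _).ne this
  have h1 := ProbabilityTheory.hasDerivAt_mgf hset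
  have h2 : HasDerivAt (fun s : ℝ => Real.exp (-x * (-s) ^ α))
      (Real.exp (-x * q ^ α) * (-x * (-1 * α * q ^ (α - 1)))) (-q) := by
    have h3 : HasDerivAt (fun s : ℝ => -s) (-1) (-q) := hasDerivAt_neg _
    have h4 := ((h3.rpow_const (p := α) (Or.inl (by simpa using hq.ne'))).const_mul (-x)).exp
    simpa using h4
  have h5 : HasDerivAt (fun s : ℝ => Real.exp (-x * (-s) ^ α)) _ (-q) := h1.congr_of_eventuallyEq (by
    filter_upwards [Iio_mem_nhds (show -q < 0 by linarith)] with s hs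
    rw [hm s hs])
  have h6 := h5.unique h2
  rw [hint] at h6
  have : ∀ t, Real.exp (-q * t) * (t / x * f t) = x⁻¹ * (f t * (id t * Real.exp (-q * id t))) := by
    intro t; simp only [id]; ring
  simp_rw [this]
  rw [integral_const_mul, h6]
  field_simp

lemma lint_exp (x c : ℝ) (hx : 0 < x) (hc : 0 < c) :
    ∫⁻ y in Ioo (0:ℝ) x, ENNReal.ofReal (Real.exp (-y * c)) =
      ENNReal.ofReal ((1 - Real.exp (-x * c)) / c) := by
  have hi : IntegrableOn (fun y => Real.exp (-y * c)) (Ioo 0 x) :=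
    (Continuous.integrableOn_Icc (by fun_prop)).mono_set Ioo_subset_Icc_self
  rw [← ofReal_integral_eq_lintegral_ofReal hi
    (Filter.Eventually.of_forall fun _ => (Real.exp_pos _).le)]
  congr 1
  rw [← integral_Ioc_eq_integral_Ioo, ← intervalIntegral.integral_of_le hx.le]
  rw [intervalIntegral.integral_eq_sub_of_hasDerivAt (f := fun y => - Real.exp (-y * c) / c)]
  · simp; ring
  · intro y _
    have h1 : HasDerivAt (fun y : ℝ => -y) (-1) y := hasDerivAt_neg y
    have h2 : HasDerivAt (fun y : ℝ => -Real.exp (-y * c) / c)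
      (-(Real.exp (-y * c) * (-1 * c)) / c) y := ((h1.mul_const c).exp.neg).div_const c
    have h3 : -(Real.exp (-y * c) * (-1 * c)) / c = Real.exp (-y * c) := by
      field_simp
    rwa [h3] at h2
  · exact Continuous.intervalIntegrable (by fun_prop) _ _

/-- Kernels on the half line to which the convolution continuity lemma applies. -/
structure NiceKer (W : ℝ → ENNReal) : Prop where
  meas : Measurable W
  zero : ∀ s ≤ (0:ℝ), W s = 0
  cont : ∀ s > (0:ℝ), ContinuousAt W s
  bdd : ∀ δ > (0:ℝ), ∃ K : ENNReal, K ≠ ⊤ ∧ ∀ s > δ, W s ≤ K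
  int : ∀ R : ℝ, ∫⁻ s in Iio R, W s ≠ ⊤

lemma NiceKer.ne_top {W : ℝ → ENNReal} (h : NiceKer W) (s : ℝ) : W s ≠ ⊤ := by
  rcases le_or_gt s 0 with hs | hs
  · rw [h.zero s hs]; simp
  · obtain ⟨K, hK, hb⟩ := h.bdd (s / 2) (by linarith)
    exact ne_top_of_le_ne_top hK (hb s (by linarith))

lemma int_of_lap (W : ℝ → ENNReal) (h : ∫⁻ s, ek 1 s * W s ≠ ⊤) (R : ℝ) :
    ∫⁻ s in Iio R, W s ≠ ⊤ := by
  have h1 : ∫⁻ s in Iio R, ek 1 R * W s ≤ ∫⁻ s, ek 1 s * W s := by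
    refine le_trans (setLIntegral_mono' measurableSet_Iio fun s hs => ?_)
      (setLIntegral_le_lintegral (Iio R) _)
    gcongr
    unfold ek
    apply ENNReal.ofReal_le_ofReal
    apply Real.exp_le_exp.2
    simp only [mem_Iio] at hs
    linarith
  rw [lintegral_const_mul' _ _ (ek_ne_top _ _)] at h1
  intro ht
  rw [ht, ENNReal.mul_top (ek_ne_zero _ _)] at h1
  exact h (top_le_iff.1 h1)

lemma conv_cont1 (W V : ℝ → ENNReal) (hW : NiceKer W) (hV : NiceKer V) (t₀ : ℝ) (ht : 0 < t₀) :
    ContinuousAt (fun t => ∫⁻ s, W s * (Ioi (t₀ / 2)).indicator V (t - s)) t₀ := by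
  obtain ⟨K, hK, hb⟩ := hV.bdd (t₀ / 2) (by linarith)
  have hVm := hV.meas.indicator (measurableSet_Ioi (a := t₀ / 2))
  refine tendsto_lintegral_filter_of_dominated_convergence
    (fun s => (Iio (2 * t₀)).indicator W s * K) ?_ ?_ ?_ ?_
  · exact Filter.Eventually.of_forall fun t => hW.meas.mul (hVm.comp (measurable_const.sub measurable_id))
  · filter_upwards [Iio_mem_nhds (show t₀ < 2 * t₀ by linarith)] with t ht'
    refine Filter.Eventually.of_forall fun s => ?_
    by_cases hs : t₀ / 2 < t - s
    · have : s ∈ Iio (2 * t₀) := by simp only [mem_Iio] at ht' ⊢; linarith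
      rw [indicator_of_mem this, indicator_of_mem (show t - s ∈ Ioi (t₀ / 2) from hs)]
      gcongr
      exact hb _ hs
    · rw [indicator_of_notMem (show t - s ∉ Ioi (t₀ / 2) from hs)]; simp
  · rw [lintegral_mul_const' _ _ hK, lintegral_indicator measurableSet_Iio]
    exact ENNReal.mul_ne_top (hW.int _) hK
  · have : ∀ᵐ s : ℝ, s ≠ t₀ / 2 := by simp [ae_iff]
    filter_upwards [this] with s hs
    refine ENNReal.Tendsto.const_mul ?_ (Or.inr (hW.ne_top s))
    have h1 : Filter.Tendsto (fun t => t - s) (nhds t₀) (nhds (t₀ - s)) :=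
      (continuous_id.sub continuous_const).tendsto t₀
    refine Filter.Tendsto.comp (g := (Ioi (t₀ / 2)).indicator V) (y := nhds (t₀ - s)) ?_ h1
    rcases lt_or_gt_of_ne hs with h | h
    · have hmem : t₀ - s ∈ Ioi (t₀ / 2) := by simp only [mem_Ioi]; linarith
      rw [indicator_of_mem hmem]
      refine (hV.cont (t₀ - s) (by linarith)).tendsto.congr' ?_
      filter_upwards [Ioi_mem_nhds hmem] with u hu
      rw [indicator_of_mem hu]
    · have hmem : t₀ - s ∈ Iio (t₀ / 2) := by simp only [mem_Iio]; linarith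
      rw [indicator_of_notMem (by simp only [mem_Ioi, not_lt]; exact le_of_lt hmem)]
      refine tendsto_const_nhds.congr' ?_
      filter_upwards [Iio_mem_nhds hmem] with u hu
      rw [indicator_of_notMem (by simp only [mem_Ioi, not_lt]; exact le_of_lt hu)]

lemma conv_cont2 (W V : ℝ → ENNReal) (hW : NiceKer W) (hV : NiceKer V) (t₀ : ℝ) (ht : 0 < t₀) :
    ContinuousAt (fun t => ∫⁻ u, (Iic (t₀ / 2)).indicator V u * W (t - u)) t₀ := by
  obtain ⟨K, hK, hb⟩ := hW.bdd (t₀ / 4) (by linarith)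
  have hVm := hV.meas.indicator (measurableSet_Iic (a := t₀ / 2))
  refine tendsto_lintegral_filter_of_dominated_convergence
    (fun u => (Iio t₀).indicator V u * K) ?_ ?_ ?_ ?_
  · exact Filter.Eventually.of_forall fun t => hVm.mul (hW.meas.comp (measurable_const.sub measurable_id))
  · filter_upwards [Ioi_mem_nhds (show 3 * t₀ / 4 < t₀ by linarith)] with t ht'
    refine Filter.Eventually.of_forall fun u => ?_
    by_cases hu : u ≤ t₀ / 2
    · have : u ∈ Iio t₀ := by simp only [mem_Iio]; linarith
      rw [indicator_of_mem this, indicator_of_mem (show u ∈ Iic (t₀ / 2) from hu)]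
      gcongr
      refine hb _ ?_
      simp only [mem_Ioi] at ht'
      linarith
    · rw [indicator_of_notMem (show u ∉ Iic (t₀ / 2) from hu)]; simp
  · rw [lintegral_mul_const' _ _ hK, lintegral_indicator measurableSet_Iio]
    exact ENNReal.mul_ne_top (hV.int _) hK
  · refine Filter.Eventually.of_forall fun u => ?_
    by_cases hu : u ≤ t₀ / 2
    · rw [indicator_of_mem (show u ∈ Iic (t₀ / 2) from hu)]
      refine ENNReal.Tendsto.const_mul ?_ (Or.inr (hV.ne_top u))
      have h1 : Filter.Tendsto (fun t => t - u) (nhds t₀) (nhds (t₀ - u)) :=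
        (continuous_id.sub continuous_const).tendsto t₀
      exact Filter.Tendsto.comp (hW.cont (t₀ - u) (by linarith)).tendsto h1
    · rw [indicator_of_notMem (show u ∉ Iic (t₀ / 2) from hu)]
      simp

lemma conv_cont (W V : ℝ → ENNReal) (hW : NiceKer W) (hV : NiceKer V) (t₀ : ℝ) (ht : 0 < t₀) :
    ContinuousAt (fun t => ∫⁻ s, W s * V (t - s)) t₀ := by
  have h := (conv_cont1 W V hW hV t₀ ht).add (conv_cont2 W V hW hV t₀ ht)
  convert h using 1
  ext t
  have hVm := hV.meas.indicator (measurableSet_Ioi (a := t₀ / 2))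
  have h2 : ∫⁻ u, (Iic (t₀ / 2)).indicator V u * W (t - u) =
      ∫⁻ s, W s * (Iic (t₀ / 2)).indicator V (t - s) := by
    rw [← lintegral_sub_left_eq_self _ t]
    refine lintegral_congr fun s => ?_
    rw [mul_comm]; congr 2; ring
  simp only [Pi.add_apply]
  have hm3 : Measurable fun s => W s * (Ioi (t₀ / 2)).indicator V (t - s) :=
    hW.meas.mul (hVm.comp (measurable_const.sub measurable_id))
  rw [h2, ← lintegral_add_left hm3]
  refine lintegral_congr fun s => ?_
  rw [← mul_add]
  congr 1
  by_cases hs : t - s ≤ t₀ / 2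
  · rw [indicator_of_notMem (show t - s ∉ Ioi (t₀ / 2) by simpa using hs),
      indicator_of_mem (show t - s ∈ Iic (t₀ / 2) from hs), zero_add]
  · rw [indicator_of_mem (show t - s ∈ Ioi (t₀ / 2) from not_le.1 hs),
      indicator_of_notMem (show t - s ∉ Iic (t₀ / 2) from hs), add_zero]

lemma lap_conv (W V : ℝ → ENNReal) (hW : Measurable W) (hV : Measurable V)
    (hW0 : ∀ s ≤ (0:ℝ), W s = 0) (hV0 : ∀ s ≤ (0:ℝ), V s = 0) (q : ℝ) :
    ∫⁻ t in Ioi (0:ℝ), ek q t * ∫⁻ s, W s * V (t - s) =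
      (∫⁻ s, ek q s * W s) * ∫⁻ u, ek q u * V u := by
  have h0 : ∫⁻ t in Ioi (0:ℝ), ek q t * ∫⁻ s, W s * V (t - s) =
      ∫⁻ t, ek q t * ∫⁻ s, W s * V (t - s) := by
    rw [← lintegral_indicator measurableSet_Ioi]
    refine lintegral_congr fun t => ?_
    by_cases ht : t ∈ Ioi (0:ℝ)
    · rw [indicator_of_mem ht]
    · rw [indicator_of_notMem ht]
      simp only [mem_Ioi, not_lt] at ht
      have : ∀ s, W s * V (t - s) = 0 := by
        intro s
        rcases le_or_gt s 0 with hs | hs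
        · rw [hW0 s hs, zero_mul]
        · rw [hV0 (t - s) (by linarith), mul_zero]
      simp [this]
  have hWe : Measurable fun s => ek q s * W s := (measurable_ek q).mul hW
  have hVe : Measurable fun s => ek q s * V s := (measurable_ek q).mul hV
  rw [h0]
  have h1 : ∀ t, ek q t * ∫⁻ s, W s * V (t - s) =
      ∫⁻ s, (ek q s * W s) * (ek q (t - s) * V (t - s)) := by
    intro t
    rw [← lintegral_const_mul' _ _ (ek_ne_top _ _)]
    refine lintegral_congr fun s => ?_
    rw [ek_split q s t]; ring
  simp_rw [h1]
  rw [lintegral_lintegral_swap]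
  · have h2 : ∀ s, ∫⁻ t, (ek q s * W s) * (ek q (t - s) * V (t - s)) =
        (ek q s * W s) * ∫⁻ u, ek q u * V u := by
      intro s
      have hm3 : Measurable fun t => ek q (t - s) * V (t - s) :=
        hVe.comp (measurable_id.sub measurable_const)
      rw [lintegral_const_mul _ hm3]
      congr 1
      exact lintegral_sub_right_eq_self (fun u => ek q u * V u) s
    simp_rw [h2]
    rw [lintegral_mul_const _ hWe]
  · exact ((hWe.comp measurable_snd).mul
      (hVe.comp (measurable_fst.sub measurable_snd))).aemeasurable

/-- The power kernel. -/
def Fk (α : ℝ) : ℝ → ENNReal := (Ioi 0).indicator (fun s => ENNReal.ofReal (s ^ (-(2 * α))))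

/-- The stable density extended by zero. -/
def Hk (p : ℝ → ℝ → ℝ) (y : ℝ) : ℝ → ENNReal := (Ioi 0).indicator (fun s => ENNReal.ofReal (p y s))

/-- The truncated potential density. -/
def Uk (p : ℝ → ℝ → ℝ) (x u : ℝ) : ENNReal := ∫⁻ y in Ioo (0:ℝ) x, Hk p y u

lemma Fk_zero (α s : ℝ) (hs : s ≤ 0) : Fk α s = 0 :=
  indicator_of_notMem (by simpa using hs) _
lemma Hk_zero (p : ℝ → ℝ → ℝ) (y s : ℝ) (hs : s ≤ 0) : Hk p y s = 0 :=
  indicator_of_notMem (by simpa using hs) _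
lemma Fk_pos (α s : ℝ) (hs : 0 < s) : Fk α s = ENNReal.ofReal (s ^ (-(2 * α))) :=
  indicator_of_mem (by simpa using hs) _
lemma Hk_pos (p : ℝ → ℝ → ℝ) (y s : ℝ) (hs : 0 < s) : Hk p y s = ENNReal.ofReal (p y s) :=
  indicator_of_mem (by simpa using hs) _
lemma Uk_zero (p : ℝ → ℝ → ℝ) (x s : ℝ) (hs : s ≤ 0) : Uk p x s = 0 := by
  simp [Uk, Hk_zero p _ s hs]

lemma Fk_meas (α : ℝ) : Measurable (Fk α) := by
  unfold Fk
  exact Measurable.indicator (by fun_prop) measurableSet_Ioi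

lemma Hk_meas2 (p : ℝ → ℝ → ℝ) (hp : Measurable (Function.uncurry p)) :
    Measurable (fun z : ℝ × ℝ => Hk p z.1 z.2) := by
  have : (fun z : ℝ × ℝ => Hk p z.1 z.2) =
      (Prod.snd ⁻¹' (Ioi (0:ℝ))).indicator (fun z => ENNReal.ofReal (Function.uncurry p z)) := by
    ext z
    by_cases hz : 0 < z.2
    · rw [Hk_pos _ _ _ hz, indicator_of_mem (by simpa using hz)]; rfl
    · rw [Hk_zero _ _ _ (not_lt.1 hz), indicator_of_notMem (by simpa using hz)]
  rw [this]
  exact (ENNReal.measurable_ofReal.comp hp).indicator (measurable_snd measurableSet_Ioi)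

lemma Uk_meas (p : ℝ → ℝ → ℝ) (hp : Measurable (Function.uncurry p)) (x : ℝ) :
    Measurable (Uk p x) := by
  unfold Uk
  have h := (Hk_meas2 p hp).comp measurable_swap
  exact Measurable.lintegral_prod_right' (f := fun z : ℝ × ℝ => Hk p z.2 z.1) h

lemma lap_ind (f : ℝ → ENNReal) (q : ℝ) :
    ∫⁻ s, ek q s * (Ioi (0:ℝ)).indicator f s = ∫⁻ s in Ioi (0:ℝ), ek q s * f s := by
  rw [← lintegral_indicator measurableSet_Ioi]
  refine lintegral_congr fun s => ?_
  by_cases hs : s ∈ Ioi (0:ℝ)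
  · simp [indicator_of_mem hs]
  · simp [indicator_of_notMem hs]

lemma Fk_nice (α : ℝ) (h0 : 0 < α) (h1 : α < 1 / 2) : NiceKer (Fk α) where
  meas := Fk_meas α
  zero := Fk_zero α
  cont s hs := by
    have : ContinuousAt (fun s : ℝ => ENNReal.ofReal (s ^ (-(2 * α)))) s :=
      (ENNReal.continuous_ofReal.continuousAt).comp
        (Real.continuousAt_rpow_const _ _ (Or.inl hs.ne'))
    refine this.congr ?_
    filter_upwards [Ioi_mem_nhds hs] with u hu
    rw [Fk_pos α u hu]
  bdd δ hδ := by
    refine ⟨ENNReal.ofReal (δ ^ (-(2 * α))), ENNReal.ofReal_ne_top, fun s hs => ?_⟩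
    rw [Fk_pos α s (hδ.trans hs)]
    exact ENNReal.ofReal_le_ofReal
      (Real.rpow_le_rpow_of_nonpos hδ (le_of_lt hs) (by linarith))
  int := by
    apply int_of_lap
    unfold Fk
    rw [lap_ind, lap_gamma (2 * α) 1 (by linarith) one_pos]
    exact ENNReal.ofReal_ne_top

lemma lap_Uk (α : ℝ) (p : ℝ → ℝ → ℝ) (hp_meas : Measurable (Function.uncurry p))
    (hp_nonneg : ∀ x > (0:ℝ), ∀ t > (0:ℝ), 0 ≤ p x t)
    (hp_lap : ∀ x > (0:ℝ), ∀ q > (0:ℝ),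
      (∫ t in Ioi (0:ℝ), Real.exp (-q * t) * p x t) = Real.exp (-x * q ^ α))
    (x q : ℝ) (hx : 0 < x) (hq : 0 < q) :
    ∫⁻ u, ek q u * Uk p x u = ENNReal.ofReal ((1 - Real.exp (-x * q ^ α)) / q ^ α) := by
  rw [← lint_exp x (q ^ α) hx (Real.rpow_pos_of_pos hq _)]
  have h1 : ∀ u, ek q u * Uk p x u = ∫⁻ y in Ioo (0:ℝ) x, ek q u * Hk p y u := by
    intro u
    rw [lintegral_const_mul' _ _ (ek_ne_top _ _)]; rfl
  simp_rw [h1]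
  rw [lintegral_lintegral_swap]
  · refine setLIntegral_congr_fun measurableSet_Ioo fun y hy => ?_
    unfold Hk
    rw [lap_ind]
    exact lint_of_int (p y) (hp_nonneg y hy.1) _ _ (Real.exp_pos _) (hp_lap y hy.1 q hq)
  · exact (((measurable_ek q).comp measurable_fst).mul
      ((Hk_meas2 p hp_meas).comp measurable_swap)).aemeasurable

lemma ae_identity (α : ℝ) (h0 : 0 < α) (h1 : α < 1 / 2)
    (p : ℝ → ℝ → ℝ) (hp_meas : Measurable (Function.uncurry p))
    (hp_nonneg : ∀ x > (0:ℝ), ∀ t > (0:ℝ), 0 ≤ p x t)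
    (hp_lap : ∀ x > (0:ℝ), ∀ q > (0:ℝ),
      (∫ t in Ioi (0:ℝ), Real.exp (-q * t) * p x t) = Real.exp (-x * q ^ α))
    (x : ℝ) (hx : 0 < x) :
    (fun t => ENNReal.ofReal (α / Real.Gamma (1 - α) * t ^ (-α)))
      =ᵐ[volume.restrict (Ioi (0:ℝ))]
    (fun t => ENNReal.ofReal (t / x * p x t) + ENNReal.ofReal (α / Real.Gamma (1 - 2 * α)) *
      ∫⁻ s, Fk α s * Uk p x (t - s)) := by
  have hG1 : 0 < Real.Gamma (1 - α) := Real.Gamma_pos_of_pos (by linarith)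
  have hG2 : 0 < Real.Gamma (1 - 2 * α) := Real.Gamma_pos_of_pos (by linarith)
  have hpx : Measurable (p x) := hp_meas.comp measurable_prodMk_left
  have hconv : Measurable fun t => ∫⁻ s, Fk α s * Uk p x (t - s) :=
    Measurable.lintegral_prod_right' (f := fun z : ℝ × ℝ => Fk α z.2 * Uk p x (z.1 - z.2))
      (((Fk_meas α).comp measurable_snd).mul
        ((Uk_meas p hp_meas x).comp (measurable_fst.sub measurable_snd)))
  have hA : ∀ q > (0:ℝ), ∫⁻ t in Ioi (0:ℝ),
      ek q t * ENNReal.ofReal (α / Real.Gamma (1 - α) * t ^ (-α)) =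
      ENNReal.ofReal (α * q ^ (α - 1)) := by
    intro q hq
    have : ∀ t, ek q t * ENNReal.ofReal (α / Real.Gamma (1 - α) * t ^ (-α)) =
        ENNReal.ofReal (α / Real.Gamma (1 - α)) * (ek q t * ENNReal.ofReal (t ^ (-α))) := by
      intro t
      rw [ENNReal.ofReal_mul (by positivity)]; ring
    simp_rw [this]
    rw [lintegral_const_mul' _ _ ENNReal.ofReal_ne_top, lap_gamma α q (by linarith) hq,
      ← ENNReal.ofReal_mul (by positivity)]
    congr 1
    field_simp
  refine laplace_unique_s3 _ _ (by fun_prop) (by fun_prop) ?_ ?_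
  · intro q hq
    rw [hA q hq]; exact ENNReal.ofReal_ne_top
  · intro q hq
    rw [hA q hq]
    have hqa : 0 < q ^ α := Real.rpow_pos_of_pos hq _
    have : ∀ t, ek q t * (ENNReal.ofReal (t / x * p x t) +
        ENNReal.ofReal (α / Real.Gamma (1 - 2 * α)) * ∫⁻ s, Fk α s * Uk p x (t - s)) =
        ek q t * ENNReal.ofReal (t / x * p x t) + ENNReal.ofReal (α / Real.Gamma (1 - 2 * α)) *
          (ek q t * ∫⁻ s, Fk α s * Uk p x (t - s)) := by
      intro t; ring
    simp_rw [this]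
    have hm3 : Measurable fun t => ek q t * ENNReal.ofReal (t / x * p x t) :=
      (measurable_ek q).mul (by fun_prop)
    rw [lintegral_add_left hm3,
      lap_tp (p x) hpx (hp_nonneg x hx) x α hx h0 (hp_lap x hx) q hq,
      lintegral_const_mul' _ _ ENNReal.ofReal_ne_top,
      lap_conv _ _ (Fk_meas α) (Uk_meas p hp_meas x) (Fk_zero α) (Uk_zero p x),
      lap_Uk α p hp_meas hp_nonneg hp_lap x q hx hq]
    unfold Fk
    have hle : Real.exp (-x * q ^ α) ≤ 1 := by
      rw [Real.exp_le_one_iff]; nlinarith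
    have hn : 0 ≤ (1 - Real.exp (-x * q ^ α)) / q ^ α := div_nonneg (by linarith) hqa.le
    rw [lap_ind, lap_gamma (2 * α) q (by linarith) hq, ← ENNReal.ofReal_mul (by positivity),
      ← ENNReal.ofReal_mul (by positivity), ← ENNReal.ofReal_add (by positivity) (by positivity)]
    congr 1
    have hr : q ^ (2 * α - 1) = q ^ (α - 1) * q ^ α := by
      rw [← Real.rpow_add hq]; congr 1; ring
    rw [hr]
    generalize Real.Gamma (1 - 2 * α) = g at hG2 ⊢
    generalize Real.exp (-x * q ^ α) = e
    field_simp
    ring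

lemma p_bound (α : ℝ) (h0 : 0 < α) (h1 : α < 1 / 2)
    (p : ℝ → ℝ → ℝ) (hp_meas : Measurable (Function.uncurry p))
    (hp_cont : ∀ x > (0:ℝ), ContinuousOn (p x) (Ioi 0))
    (hp_nonneg : ∀ x > (0:ℝ), ∀ t > (0:ℝ), 0 ≤ p x t)
    (hp_lap : ∀ x > (0:ℝ), ∀ q > (0:ℝ),
      (∫ t in Ioi (0:ℝ), Real.exp (-q * t) * p x t) = Real.exp (-x * q ^ α))
    (x : ℝ) (hx : 0 < x) (t : ℝ) (ht : 0 < t) :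
    t / x * p x t ≤ α / Real.Gamma (1 - α) * t ^ (-α) := by
  have hG1 : 0 < Real.Gamma (1 - α) := Real.Gamma_pos_of_pos (by linarith)
  have hc1 : ContinuousOn (fun t : ℝ => α / Real.Gamma (1 - α) * t ^ (-α)) (Ioi 0) :=
    continuousOn_const.mul (continuousOn_id.rpow_const fun s hs => Or.inl (ne_of_gt hs))
  have hc2 : ContinuousOn (fun t : ℝ => t / x * p x t) (Ioi 0) :=
    (continuousOn_id.div_const x).mul (hp_cont x hx)
  have hae : (fun t : ℝ => max (t / x * p x t) (α / Real.Gamma (1 - α) * t ^ (-α)))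
      =ᵐ[volume.restrict (Ioi (0:ℝ))] (fun t : ℝ => α / Real.Gamma (1 - α) * t ^ (-α)) := by
    filter_upwards [ae_identity α h0 h1 p hp_meas hp_nonneg hp_lap x hx,
      ae_restrict_mem measurableSet_Ioi] with t ht htp
    apply max_eq_right
    have h2 : ENNReal.ofReal (t / x * p x t) ≤
        ENNReal.ofReal (α / Real.Gamma (1 - α) * t ^ (-α)) := by
      rw [ht]; exact le_self_add
    refine (ENNReal.ofReal_le_ofReal_iff ?_).1 h2
    simp only [mem_Ioi] at htp
    positivity
  have := Measure.eqOn_open_of_ae_eq hae isOpen_Ioi (hc2.sup hc1) hc1 ht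
  exact max_eq_right_iff.1 this

lemma Uk_nice (α : ℝ) (h0 : 0 < α) (h1 : α < 1 / 2)
    (p : ℝ → ℝ → ℝ) (hp_meas : Measurable (Function.uncurry p))
    (hp_cont : ∀ x > (0:ℝ), ContinuousOn (p x) (Ioi 0))
    (hp_nonneg : ∀ x > (0:ℝ), ∀ t > (0:ℝ), 0 ≤ p x t)
    (hp_lap : ∀ x > (0:ℝ), ∀ q > (0:ℝ),
      (∫ t in Ioi (0:ℝ), Real.exp (-q * t) * p x t) = Real.exp (-x * q ^ α))
    (x : ℝ) (hx : 0 < x) : NiceKer (Uk p x) := by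
  have hG1 : 0 < Real.Gamma (1 - α) := Real.Gamma_pos_of_pos (by linarith)
  have hb : ∀ δ > (0:ℝ), ∀ s > δ, ∀ y ∈ Ioo 0 x, Hk p y s ≤
      ENNReal.ofReal (α / Real.Gamma (1 - α) * δ ^ (-α) * (x / δ)) := by
    intro δ hδ s hs y hy
    have hs0 : 0 < s := hδ.trans hs
    have hy0 : 0 < y := hy.1
    rw [Hk_pos _ _ _ hs0]
    apply ENNReal.ofReal_le_ofReal
    have h2 := p_bound α h0 h1 p hp_meas hp_cont hp_nonneg hp_lap y hy.1 s hs0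
    have h3 : p y s = (s / y * p y s) * (y / s) := by field_simp
    rw [h3]
    have h4 : s ^ (-α) ≤ δ ^ (-α) :=
      Real.rpow_le_rpow_of_nonpos hδ (le_of_lt hs) (by linarith)
    have h5 : y / s ≤ x / δ := div_le_div₀ hx.le hy.2.le hδ (le_of_lt hs)
    have h6 : α / Real.Gamma (1 - α) * s ^ (-α) ≤ α / Real.Gamma (1 - α) * δ ^ (-α) := by
      gcongr
    exact mul_le_mul (h2.trans h6) h5 (by positivity) (by positivity)
  have hvol : volume (Ioo (0:ℝ) x) ≠ ⊤ := by simp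
  refine ⟨Uk_meas p hp_meas x, Uk_zero p x, ?_, ?_, ?_⟩
  · intro u hu
    unfold Uk
    refine tendsto_lintegral_filter_of_dominated_convergence
      (fun _ => ENNReal.ofReal (α / Real.Gamma (1 - α) * (u / 2) ^ (-α) * (x / (u / 2)))) ?_ ?_ ?_ ?_
    · exact Filter.Eventually.of_forall fun s =>
        (Hk_meas2 p hp_meas).comp (measurable_id.prodMk measurable_const)
    · filter_upwards [Ioi_mem_nhds (show u / 2 < u by linarith)] with s hs
      filter_upwards [ae_restrict_mem measurableSet_Ioo] with y hy
      exact hb (u / 2) (by linarith) s hs y hy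
    · rw [setLIntegral_const]
      exact ENNReal.mul_ne_top ENNReal.ofReal_ne_top hvol
    · filter_upwards [ae_restrict_mem measurableSet_Ioo] with y hy
      have h2 : ContinuousAt (fun s => ENNReal.ofReal (p y s)) u :=
        (ENNReal.continuous_ofReal.continuousAt).comp
          ((hp_cont y hy.1).continuousAt (Ioi_mem_nhds hu))
      have h3 : ContinuousAt (Hk p y) u := by
        refine h2.congr ?_
        filter_upwards [Ioi_mem_nhds hu] with s hs
        rw [Hk_pos p y s hs]
      exact h3
  · intro δ hδ
    refine ⟨_, ENNReal.mul_ne_top (ENNReal.ofReal_ne_top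
      (r := α / Real.Gamma (1 - α) * δ ^ (-α) * (x / δ))) hvol, fun s hs => ?_⟩
    rw [← setLIntegral_const]
    exact setLIntegral_mono' measurableSet_Ioo fun y hy => hb δ hδ s hs y hy
  · apply int_of_lap
    rw [lap_Uk α p hp_meas hp_nonneg hp_lap x 1 hx one_pos]
    exact ENNReal.ofReal_ne_top

lemma bochner_eq (α : ℝ) (p : ℝ → ℝ → ℝ) (hp_meas : Measurable (Function.uncurry p))
    (hp_nonneg : ∀ x > (0:ℝ), ∀ t > (0:ℝ), 0 ≤ p x t) (x t : ℝ)
    (hfin : ∫⁻ s, Fk α s * Uk p x (t - s) ≠ ⊤) :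
    ∫ y in Ioo (0:ℝ) x, ∫ s in Ioo (0:ℝ) t, s ^ (-(2 * α)) * p y (t - s) =
      (∫⁻ s, Fk α s * Uk p x (t - s)).toReal := by
  have hm2 : Measurable fun z : ℝ × ℝ => Fk α z.2 * Hk p z.1 (t - z.2) :=
    ((Fk_meas α).comp measurable_snd).mul ((Hk_meas2 p hp_meas).comp
      (measurable_fst.prodMk (measurable_const.sub measurable_snd)))
  have hsw : ∫⁻ s, Fk α s * Uk p x (t - s) =
      ∫⁻ y in Ioo (0:ℝ) x, ∫⁻ s, Fk α s * Hk p y (t - s) := by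
    rw [lintegral_lintegral_swap hm2.aemeasurable]
    refine lintegral_congr fun s => ?_
    have hm3 : Measurable fun y => Hk p y (t - s) :=
      (Hk_meas2 p hp_meas).comp (measurable_id.prodMk measurable_const)
    rw [lintegral_const_mul _ hm3]; rfl
  have hinner : ∀ y ∈ Ioo (0:ℝ) x, ∫ s in Ioo (0:ℝ) t, s ^ (-(2 * α)) * p y (t - s) =
      (∫⁻ s, Fk α s * Hk p y (t - s)).toReal := by
    intro y hy
    have hpy : Measurable (p y) := hp_meas.comp measurable_prodMk_left
    rw [integral_eq_lintegral_of_nonneg_ae]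
    · congr 1
      rw [← lintegral_indicator measurableSet_Ioo]
      refine lintegral_congr fun s => ?_
      by_cases hs : s ∈ Ioo 0 t
      · rw [indicator_of_mem hs, Fk_pos α s hs.1, Hk_pos p y (t - s) (by linarith [hs.2]),
          ENNReal.ofReal_mul (Real.rpow_nonneg hs.1.le _)]
      · rw [indicator_of_notMem hs]
        rcases le_or_gt s 0 with h | h
        · rw [Fk_zero α s h, zero_mul]
        · rw [Hk_zero p y (t - s) (by
            by_contra hn
            exact hs ⟨h, by linarith⟩), mul_zero]
    · filter_upwards [ae_restrict_mem measurableSet_Ioo] with s hs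
      exact mul_nonneg (Real.rpow_nonneg hs.1.le _) (hp_nonneg y hy.1 _ (by linarith [hs.2]))
    · refine Measurable.aestronglyMeasurable ?_
      fun_prop
  rw [setIntegral_congr_fun measurableSet_Ioo hinner, hsw]
  have hmy : Measurable fun y => ∫⁻ s, Fk α s * Hk p y (t - s) :=
    Measurable.lintegral_prod_right' hm2
  rw [hsw] at hfin
  exact integral_toReal hmy.aemeasurable (ae_lt_top hmy hfin)

/-- For `α ∈ (0,1/2)` and the stable densities `p(x,·)` of index `α`,
`(α/Γ(1-α)) t^(-α) - (t/x) p(x,t)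
   = (α/Γ(1-2α)) ∫₀^x ∫₀^t s^(-2α) p(y, t-s) ds dy ≥ 0` for all `x, t > 0`. -/
theorem stable_density_identity
    (α : ℝ) (hα : α ∈ Set.Ioo (0:ℝ) (1/2))
    (p : ℝ → ℝ → ℝ)
    (hp_meas : Measurable (Function.uncurry p))
    (hp_cont : ∀ x > (0:ℝ), ContinuousOn (p x) (Ioi 0))
    (hp_nonneg : ∀ x > (0:ℝ), ∀ t > (0:ℝ), 0 ≤ p x t)
    (hp_lap : ∀ x > (0:ℝ), ∀ q > (0:ℝ),
      (∫ t in Ioi (0:ℝ), Real.exp (-q * t) * p x t) = Real.exp (-x * q ^ α)) :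
    ∀ x > (0:ℝ), ∀ t > (0:ℝ),
      (α / Real.Gamma (1 - α) * t ^ (-α) - t / x * p x t =
        α / Real.Gamma (1 - 2 * α) *
          ∫ y in Ioo (0:ℝ) x, ∫ s in Ioo (0:ℝ) t, s ^ (-(2 * α)) * p y (t - s)) ∧
      0 ≤ α / Real.Gamma (1 - α) * t ^ (-α) - t / x * p x t := by
  
  intro x hx t ht
  obtain ⟨h0, h1⟩ := hα
  have hG1 : 0 < Real.Gamma (1 - α) := Real.Gamma_pos_of_pos (by linarith)
  have hG2 : 0 < Real.Gamma (1 - 2 * α) := Real.Gamma_pos_of_pos (by linarith)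
  refine ⟨?_, sub_nonneg.2
    (p_bound α h0 h1 p hp_meas hp_cont hp_nonneg hp_lap x hx t ht)⟩
  have hc1 : ContinuousOn (fun t : ℝ => α / Real.Gamma (1 - α) * t ^ (-α)) (Ioi 0) :=
    continuousOn_const.mul (continuousOn_id.rpow_const fun s hs => Or.inl (ne_of_gt hs))
  have hc2 : ContinuousOn (fun t : ℝ => t / x * p x t) (Ioi 0) :=
    (continuousOn_id.div_const x).mul (hp_cont x hx)
  have hc3 : ContinuousOn (fun t => ∫⁻ s, Fk α s * Uk p x (t - s)) (Ioi 0) := fun s hs =>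
    (conv_cont _ _ (Fk_nice α h0 h1)
      (Uk_nice α h0 h1 p hp_meas hp_cont hp_nonneg hp_lap x hx) s hs).continuousWithinAt
  have hc4 : ContinuousOn (fun t => ENNReal.ofReal (α / Real.Gamma (1 - 2 * α)) *
      ∫⁻ s, Fk α s * Uk p x (t - s)) (Ioi 0) :=
    (ENNReal.continuous_const_mul ENNReal.ofReal_ne_top).comp_continuousOn hc3
  have key := Measure.eqOn_open_of_ae_eq
    (ae_identity α h0 h1 p hp_meas hp_nonneg hp_lap x hx) isOpen_Ioi
    (ENNReal.continuous_ofReal.comp_continuousOn hc1)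
    ((ENNReal.continuous_ofReal.comp_continuousOn hc2).add hc4) ht
  simp only at key
  have hcpos : 0 < α / Real.Gamma (1 - 2 * α) := by positivity
  have hfin : ∫⁻ s, Fk α s * Uk p x (t - s) ≠ ⊤ := by
    intro h
    rw [h, ENNReal.mul_top (by simpa using hcpos)] at key
    simp at key
  rw [bochner_eq α p hp_meas hp_nonneg x t hfin]
  have k2 := congrArg ENNReal.toReal key
  rw [ENNReal.toReal_add ENNReal.ofReal_ne_top (ENNReal.mul_ne_top ENNReal.ofReal_ne_top hfin),
    ENNReal.toReal_mul, ENNReal.toReal_ofReal (by positivity), ENNReal.toReal_ofReal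
      (mul_nonneg (by positivity) (hp_nonneg x hx t ht)), ENNReal.toReal_ofReal hcpos.le] at k2
  linarith
end
end

section
/- Let Ψ be a (sub)critical branching mechanism which is not identically zero, so that Ψ is a strictly increasing bijection of (0,∞) onto (0,∞); let Φ : (0,∞) → (0,∞) denote its inverse function and Φ' the derivative of Φ. Then the function q ↦ 1/Φ'(q) is a Bernstein function and the function q ↦ (1/Φ'(q))² is also a Bernstein function; that is, 1/Φ' is internal. -/
open MeasureTheory Real Set

noncomputable section

/-- Complete monotonicity on `(0,∞)` up to order `n`. -/
def CMn : ℕ → (ℝ → ℝ) → Prop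
  | 0, f => ∀ q > (0:ℝ), 0 ≤ f q
  | n + 1, f => (∀ q > (0:ℝ), 0 ≤ f q) ∧
      ∃ h : ℝ → ℝ, CMn n h ∧ ∀ q > (0:ℝ), HasDerivAt f (-h q) q

theorem CMn.nonneg {n : ℕ} {f : ℝ → ℝ} (h : CMn n f) : ∀ q > (0:ℝ), 0 ≤ f q := by
  cases n with
  | zero => exact h
  | succ n => exact h.1

theorem CMn.pred {n : ℕ} : ∀ {f : ℝ → ℝ}, CMn (n + 1) f → CMn n f := by
  induction n with
  | zero => intro f h; exact h.1
  | succ n ih =>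
    rintro f ⟨h0, h, hh, hd⟩
    exact ⟨h0, h, ih hh, hd⟩

theorem CMn.const (n : ℕ) : ∀ {c : ℝ}, 0 ≤ c → CMn n (fun _ => c) := by
  induction n with
  | zero => intro c hc q _; exact hc
  | succ n ih =>
    intro c hc
    refine ⟨fun q _ => hc, fun _ => 0, ih le_rfl, fun q _ => ?_⟩
    simpa using hasDerivAt_const q c

theorem CMn.add {n : ℕ} : ∀ {f g : ℝ → ℝ}, CMn n f → CMn n g → CMn n (fun q => f q + g q) := by
  induction n with
  | zero => intro f g hf hg q hq; exact add_nonneg (hf q hq) (hg q hq)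
  | succ n ih =>
    rintro f g ⟨hf, f', hf', hfd⟩ ⟨hg, g', hg', hgd⟩
    refine ⟨fun q hq => add_nonneg (hf q hq) (hg q hq), _, ih hf' hg', fun q hq => ?_⟩
    refine HasDerivAt.congr_deriv ((hfd q hq).add (hgd q hq)) ?_
    ring

theorem CMn.mul {n : ℕ} : ∀ {f g : ℝ → ℝ}, CMn n f → CMn n g → CMn n (fun q => f q * g q) := by
  induction n with
  | zero => intro f g hf hg q hq; exact mul_nonneg (hf q hq) (hg q hq)
  | succ n ih =>
    intro f g hF hG
    obtain ⟨hf, f', hf', hfd⟩ := id hF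
    obtain ⟨hg, g', hg', hgd⟩ := id hG
    refine ⟨fun q hq => mul_nonneg (hf q hq) (hg q hq), _,
      (ih hf' hG.pred).add (ih hF.pred hg'), fun q hq => ?_⟩
    refine HasDerivAt.congr_deriv ((hfd q hq).mul (hgd q hq)) ?_
    ring

theorem CMn.comp {n : ℕ} : ∀ {F φ g : ℝ → ℝ}, (∀ q > (0:ℝ), 0 < φ q) →
    (∀ q > (0:ℝ), HasDerivAt φ (g q) q) → CMn n g → CMn (n + 1) F →
    CMn (n + 1) (fun q => F (φ q)) := by
  induction n with
  | zero =>
    rintro F φ g hφ hd hg ⟨hF, h, hh, hFd⟩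
    refine ⟨fun q hq => hF _ (hφ q hq), fun q => h (φ q) * g q,
      fun q hq => mul_nonneg (hh _ (hφ q hq)) (hg q hq), fun q hq => ?_⟩
    refine HasDerivAt.congr_deriv ((hFd _ (hφ q hq)).comp q (hd q hq)) ?_
    ring
  | succ n ih =>
    rintro F φ g hφ hd hg ⟨hF, h, hh, hFd⟩
    refine ⟨fun q hq => hF _ (hφ q hq), fun q => h (φ q) * g q,
      (ih hφ hd hg.pred hh).mul hg, fun q hq => ?_⟩
    refine HasDerivAt.congr_deriv ((hFd _ (hφ q hq)).comp q (hd q hq)) ?_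
    ring

theorem CMn.iter {n : ℕ} : ∀ {f : ℝ → ℝ}, CMn n f → ∀ q > (0:ℝ),
    0 ≤ (-1 : ℝ) ^ n * iteratedDerivWithin n f (Ioi 0) q := by
  induction n with
  | zero => intro f h q hq; simpa using h q hq
  | succ n ih =>
    rintro f ⟨h0, h, hh, hd⟩ q hq
    have e : EqOn (derivWithin f (Ioi 0)) (-h) (Ioi 0) := fun x hx =>
      (hd x hx).hasDerivWithinAt.derivWithin (uniqueDiffOn_Ioi 0 x hx)
    rw [iteratedDerivWithin_succ', iteratedDerivWithin_congr e hq, iteratedDerivWithin_neg]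
    have := ih hh q hq
    simp only [pow_succ]
    linarith

theorem CMn.contDiffOn {n : ℕ} : ∀ {f : ℝ → ℝ}, CMn (n + 1) f → ContDiffOn ℝ n f (Ioi 0) := by
  induction n with
  | zero =>
    rintro f ⟨h0, h, hh, hd⟩
    simp only [Nat.cast_zero, contDiffOn_zero]
    exact fun q hq => (hd q hq).continuousAt.continuousWithinAt
  | succ n ih =>
    rintro f ⟨h0, h, hh, hd⟩
    push_cast
    rw [contDiffOn_succ_iff_deriv_of_isOpen isOpen_Ioi]
    refine ⟨fun q hq => (hd q hq).differentiableAt.differentiableWithinAt, by simp, ?_⟩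
    exact (ih hh).neg.congr fun q hq => (hd q hq).deriv

theorem isBernstein_of_CMn {f h : ℝ → ℝ} (hf : ∀ q > (0:ℝ), 0 ≤ f q)
    (hd : ∀ q > (0:ℝ), HasDerivAt f (h q) q) (hh : ∀ n, CMn n h) : IsBernstein f := by
  refine ⟨?_, hf, ?_⟩
  · rw [contDiffOn_infty]
    intro n
    have : ContDiffOn ℝ ((n : WithTop ℕ∞) + 1) f (Ioi 0) := by
      rw [contDiffOn_succ_iff_deriv_of_isOpen isOpen_Ioi]
      exact ⟨fun q hq => (hd q hq).differentiableAt.differentiableWithinAt, by simp,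
        (hh (n + 1)).contDiffOn.congr fun q hq => (hd q hq).deriv⟩
    exact this.of_le le_self_add
  · intro n hn q hq
    obtain ⟨n, rfl⟩ := Nat.exists_eq_add_of_le' hn
    have e : EqOn (derivWithin f (Ioi 0)) h (Ioi 0) := fun x hx =>
      (hd x hx).hasDerivWithinAt.derivWithin (uniqueDiffOn_Ioi 0 x hx)
    rw [iteratedDerivWithin_succ', iteratedDerivWithin_congr e hq]
    simpa using (hh n).iter q hq

theorem pow_mul_exp_bound (k : ℕ) {c x : ℝ} (hc : 0 < c) (hx : 0 ≤ x) :
    x ^ k * Real.exp (-(c * x)) ≤ k.factorial / c ^ k := by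
  have := Real.pow_div_factorial_le_exp (c * x) (by positivity) k
  rw [Real.exp_neg, ← div_eq_mul_inv, div_le_div_iff₀ (Real.exp_pos _) (by positivity)]
  rw [div_le_iff₀ (by positivity), mul_pow] at this
  linarith

section meas
variable {Pi : Measure ℝ}

theorem ae_pos (h0 : Pi (Iic 0) = 0) : ∀ᵐ x ∂Pi, 0 < x := by
  rw [ae_iff]
  convert h0 using 2
  ext x; simp

theorem integrable_min (h0 : Pi (Iic 0) = 0)
    (h1 : (∫⁻ x, ENNReal.ofReal (min x (x ^ 2)) ∂Pi) < ⊤) :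
    Integrable (fun x : ℝ => min x (x ^ 2)) Pi := by
  refine ⟨by fun_prop, ?_⟩
  rw [hasFiniteIntegral_iff_ofReal]
  · exact h1
  · filter_upwards [ae_pos h0] with x hx
    change (0:ℝ) ≤ _
    positivity

/-- pointwise bound of the first derivative -/
theorem bd1 {q x : ℝ} (hq : 0 < q) (hx : 0 < x) :
    |x * (1 - Real.exp (-q * x))| ≤ (1 + q) * min x (x ^ 2) := by
  have e0 := Real.exp_pos (-q * x)
  have e1 : Real.exp (-q * x) ≤ 1 := Real.exp_le_one_iff.2 (by nlinarith)
  have e2 := Real.add_one_le_exp (-q * x)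
  rw [abs_of_nonneg (mul_nonneg hx.le (by linarith)), mul_min_of_nonneg _ _ (by linarith)]
  refine le_min ?_ ?_
  · nlinarith [mul_pos hq hx, mul_pos hx e0]
  · have : x * (1 - Real.exp (-q * x)) ≤ x * (q * x) :=
      mul_le_mul_of_nonneg_left (by linarith) hx.le
    nlinarith [sq_nonneg x]

theorem bd0 {q x : ℝ} (hq : 0 < q) (hx : 0 < x) :
    |Real.exp (-q * x) - 1 + q * x| ≤ (q + q ^ 2) * min x (x ^ 2) := by
  have e0 := Real.exp_pos (-q * x)
  have e1 : Real.exp (-q * x) ≤ 1 := Real.exp_le_one_iff.2 (by nlinarith)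
  have e2 := Real.add_one_le_exp (-q * x)
  have hy : 0 < q * x := mul_pos hq hx
  rw [abs_of_nonneg (by linarith), mul_min_of_nonneg _ _ (by positivity)]
  refine le_min ?_ ?_
  · nlinarith [mul_pos hq hy]
  · have e3 : Real.exp (-q * x) ≤ 1 / (1 + q * x) := by
      rw [neg_mul, Real.exp_neg, ← one_div]
      exact one_div_le_one_div_of_le (by linarith) (by linarith [Real.add_one_le_exp (q * x)])
    have e4 : 1 / (1 + q * x) ≤ 1 - q * x + (q * x) ^ 2 := by
      rw [div_le_iff₀ (by linarith)]
      nlinarith [pow_pos hy 3]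
    nlinarith [mul_pos hq (pow_pos hx 2)]

theorem bd2 (n : ℕ) {c : ℝ} (hc : 0 < c) : ∃ C : ℝ, ∀ q x : ℝ, c ≤ q → 0 < x →
    |x ^ (n + 2) * Real.exp (-q * x)| ≤ C * min x (x ^ 2) := by
  refine ⟨(n + 1).factorial / c ^ (n + 1) + n.factorial / c ^ n, fun q x hq hx => ?_⟩
  have h1 := pow_mul_exp_bound (n + 1) hc hx.le
  have h2 := pow_mul_exp_bound n hc hx.le
  have e : Real.exp (-q * x) ≤ Real.exp (-(c * x)) := Real.exp_le_exp.2 (by nlinarith)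
  have p1 : 0 ≤ ((n + 1).factorial : ℝ) / c ^ (n + 1) := by positivity
  have p2 : 0 ≤ (n.factorial : ℝ) / c ^ n := by positivity
  rw [abs_of_nonneg (by positivity)]
  refine (mul_le_mul_of_nonneg_left e (by positivity)).trans ?_
  rw [mul_min_of_nonneg _ _ (by positivity)]
  refine le_min ?_ ?_
  · calc x ^ (n + 2) * Real.exp (-(c * x)) = (x ^ (n + 1) * Real.exp (-(c * x))) * x := by ring
      _ ≤ _ := mul_le_mul_of_nonneg_right (by linarith) hx.le
  · calc x ^ (n + 2) * Real.exp (-(c * x)) = (x ^ n * Real.exp (-(c * x))) * x ^ 2 := by ring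
      _ ≤ _ := mul_le_mul_of_nonneg_right (by linarith) (by positivity)

theorem ball_pos {q₀ q : ℝ} (h : q ∈ Metric.ball q₀ (q₀ / 2)) : q₀ / 2 < q ∧ q < 2 * q₀ := by
  rw [Metric.mem_ball, Real.dist_eq, abs_lt] at h
  constructor <;> linarith

theorem hasDerivAt_I0 (h0 : Pi (Iic 0) = 0)
    (h1 : (∫⁻ x, ENNReal.ofReal (min x (x ^ 2)) ∂Pi) < ⊤) {q : ℝ} (hq : 0 < q) :
    HasDerivAt (fun q => ∫ x, (Real.exp (-q * x) - 1 + q * x) ∂Pi)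
      (∫ x, x * (1 - Real.exp (-q * x)) ∂Pi) q := by
  have hm := integrable_min h0 h1
  refine (hasDerivAt_integral_of_dominated_loc_of_deriv_le (μ := Pi) (𝕜 := ℝ)
    (F := fun q x => Real.exp (-q * x) - 1 + q * x)
    (F' := fun q x => x * (1 - Real.exp (-q * x)))
    (bound := fun x => (1 + 2 * q) * min x (x ^ 2))
    (Metric.ball_mem_nhds q (half_pos hq)) ?_ ?_ ?_ ?_ ?_ ?_).2
  · exact .of_forall fun _ => by fun_prop
  · refine (hm.const_mul (q + q ^ 2)).mono' (by fun_prop) ?_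
    filter_upwards [ae_pos h0] with x hx using bd0 hq hx
  · fun_prop
  · filter_upwards [ae_pos h0] with x hx p hp
    have := ball_pos hp
    refine (bd1 (by linarith) hx).trans ?_
    have : 0 < min x (x ^ 2) := by positivity
    gcongr
    linarith
  · exact hm.const_mul _
  · refine .of_forall fun x p _ => ?_
    have := (((hasDerivAt_id p).neg.mul_const x).exp.sub_const 1).add
      ((hasDerivAt_id p).mul_const x)
    refine this.congr_deriv ?_
    simp; ring

theorem hasDerivAt_I1 (h0 : Pi (Iic 0) = 0)
    (h1 : (∫⁻ x, ENNReal.ofReal (min x (x ^ 2)) ∂Pi) < ⊤) {q : ℝ} (hq : 0 < q) :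
    HasDerivAt (fun q => ∫ x, x * (1 - Real.exp (-q * x)) ∂Pi)
      (∫ x, x ^ 2 * Real.exp (-q * x) ∂Pi) q := by
  have hm := integrable_min h0 h1
  obtain ⟨C, hC⟩ := bd2 0 (half_pos hq)
  refine (hasDerivAt_integral_of_dominated_loc_of_deriv_le (μ := Pi) (𝕜 := ℝ)
    (F := fun q x => x * (1 - Real.exp (-q * x)))
    (F' := fun q x => x ^ 2 * Real.exp (-q * x))
    (bound := fun x => C * min x (x ^ 2))
    (Metric.ball_mem_nhds q (half_pos hq)) ?_ ?_ ?_ ?_ ?_ ?_).2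
  · exact .of_forall fun _ => by fun_prop
  · refine (hm.const_mul (1 + q)).mono' (by fun_prop) ?_
    filter_upwards [ae_pos h0] with x hx using bd1 hq hx
  · fun_prop
  · filter_upwards [ae_pos h0] with x hx p hp
    exact hC p x (ball_pos hp).1.le hx
  · exact hm.const_mul _
  · refine .of_forall fun x p _ => ?_
    have := (((hasDerivAt_id p).neg.mul_const x).exp.const_sub 1).const_mul x
    refine this.congr_deriv ?_
    simp; ring

theorem hasDerivAt_J (h0 : Pi (Iic 0) = 0)
    (h1 : (∫⁻ x, ENNReal.ofReal (min x (x ^ 2)) ∂Pi) < ⊤) (n : ℕ) {q : ℝ} (hq : 0 < q) :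
    HasDerivAt (fun q => ∫ x, x ^ (n + 2) * Real.exp (-q * x) ∂Pi)
      (-∫ x, x ^ (n + 1 + 2) * Real.exp (-q * x) ∂Pi) q := by
  have hm := integrable_min h0 h1
  obtain ⟨C, hC⟩ := bd2 (n + 1) (half_pos hq)
  obtain ⟨D, hD⟩ := bd2 n hq
  rw [← integral_neg]
  refine (hasDerivAt_integral_of_dominated_loc_of_deriv_le (μ := Pi) (𝕜 := ℝ)
    (F := fun q x => x ^ (n + 2) * Real.exp (-q * x))
    (F' := fun q x => -(x ^ (n + 1 + 2) * Real.exp (-q * x)))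
    (bound := fun x => C * min x (x ^ 2))
    (Metric.ball_mem_nhds q (half_pos hq)) ?_ ?_ ?_ ?_ ?_ ?_).2
  · exact .of_forall fun _ => by fun_prop
  · refine (hm.const_mul D).mono' (by fun_prop) ?_
    filter_upwards [ae_pos h0] with x hx using hD q x le_rfl hx
  · fun_prop
  · filter_upwards [ae_pos h0] with x hx p hp
    rw [norm_neg]
    exact hC p x (ball_pos hp).1.le hx
  · exact hm.const_mul _
  · refine .of_forall fun x p _ => ?_
    have := (((hasDerivAt_id p).neg.mul_const x).exp).const_mul (x ^ (n + 2))
    refine this.congr_deriv ?_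
    simp; ring

theorem CMn_J (h0 : Pi (Iic 0) = 0)
    (h1 : (∫⁻ x, ENNReal.ofReal (min x (x ^ 2)) ∂Pi) < ⊤) (k : ℕ) :
    ∀ n : ℕ, CMn k (fun q => ∫ x, x ^ (n + 2) * Real.exp (-q * x) ∂Pi) := by
  have nn : ∀ n : ℕ, ∀ q > (0:ℝ), 0 ≤ ∫ x, x ^ (n + 2) * Real.exp (-q * x) ∂Pi := by
    intro n q _
    refine integral_nonneg_of_ae ?_
    filter_upwards [ae_pos h0] with x hx
    change (0:ℝ) ≤ _
    positivity
  induction k with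
  | zero => exact nn
  | succ k ih => exact fun n => ⟨nn n, _, ih (n + 1), fun q hq => hasDerivAt_J h0 h1 n hq⟩

end meas

/-- A branching mechanism has a nonnegative derivative whose derivative is completely monotone. -/
theorem IsBranchingMechanism.derivs {Ψ : ℝ → ℝ} (hΨ : IsBranchingMechanism Ψ) :
    ∃ D E : ℝ → ℝ, (∀ q > (0:ℝ), HasDerivAt Ψ (D q) q) ∧ (∀ q > (0:ℝ), HasDerivAt D (E q) q) ∧
      (∀ q > (0:ℝ), 0 ≤ D q) ∧ ∀ n, CMn n E := by
  obtain ⟨a, b, Pi, ha, hb, h0, h1, h⟩ := hΨ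
  refine ⟨fun q => a + 2 * b * q + ∫ x, x * (1 - Real.exp (-q * x)) ∂Pi,
    fun q => 2 * b + ∫ x, x ^ (0 + 2) * Real.exp (-q * x) ∂Pi, ?_, ?_, ?_, ?_⟩
  · intro q hq
    have : HasDerivAt (fun q => a * q + b * q ^ 2 + ∫ x, (Real.exp (-q * x) - 1 + q * x) ∂Pi)
        (a + 2 * b * q + ∫ x, x * (1 - Real.exp (-q * x)) ∂Pi) q := by
      refine HasDerivAt.congr_deriv ((((hasDerivAt_id q).const_mul a).add (((hasDerivAt_id q).pow 2).const_mul b)).add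
        (hasDerivAt_I0 h0 h1 hq)) ?_
      simp; ring
    refine this.congr_of_eventuallyEq ?_
    filter_upwards [Ioi_mem_nhds hq] with p hp using h p hp
  · intro q hq
    refine HasDerivAt.congr_deriv ((((hasDerivAt_id q).const_mul (2 * b)).const_add a).add
        (hasDerivAt_I1 h0 h1 hq)) ?_
    simp
  · intro q hq
    have : 0 ≤ ∫ x, x * (1 - Real.exp (-q * x)) ∂Pi := by
      refine integral_nonneg_of_ae ?_
      filter_upwards [ae_pos h0] with x hx
      have e1 : Real.exp (-q * x) ≤ 1 := Real.exp_le_one_iff.2 (by nlinarith)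
      exact mul_nonneg hx.le (by linarith)
    positivity
  · exact fun n => (CMn.const n (by positivity)).add (CMn_J h0 h1 n 0)

/-- Let `Ψ` be a nonzero (sub)critical branching mechanism, a strictly
increasing bijection of `(0,∞)` onto itself, with inverse `Φ`.  Then `1/Φ'` and
`(1/Φ')²` are Bernstein functions; i.e. `1/Φ'` is internal. -/
theorem inv_deriv_of_inverse_internal
    (Ψ : ℝ → ℝ) (hΨ : IsBranchingMechanism Ψ)
    (hΨne : ¬ (∀ q > (0:ℝ), Ψ q = 0))
    (Φ : ℝ → ℝ) (hΦpos : ∀ q > (0:ℝ), 0 < Φ q)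
    (hΦinv : ∀ q > (0:ℝ), Ψ (Φ q) = q)
    (hinvΦ : ∀ q > (0:ℝ), Φ (Ψ q) = q) :
    IsBernstein (fun q => 1 / deriv Φ q) ∧
    IsBernstein (fun q => (1 / deriv Φ q) ^ 2) := by
  obtain ⟨D, E, hD, hE, hD0, hcm⟩ := hΨ.derivs
  -- the derivative of `Ψ` is positive
  have hDpos : ∀ q > (0:ℝ), 0 < D q := by
    intro q hq
    refine lt_of_le_of_ne (hD0 q hq) fun hz => ?_
    have hmono : MonotoneOn D (Ioi 0) := by
      refine monotoneOn_of_deriv_nonneg (convex_Ioi 0)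
        (fun x hx => (hE x hx).continuousAt.continuousWithinAt)
        (fun x hx => ?_) (fun x hx => ?_)
      · rw [interior_Ioi] at hx
        exact (hE x hx).differentiableAt.differentiableWithinAt
      · rw [interior_Ioi] at hx
        rw [(hE x hx).deriv]
        exact (hcm 0).nonneg x hx
    have hDz : ∀ x ∈ Ioc 0 q, D x = 0 := fun x hx =>
      le_antisymm (hz ▸ hmono hx.1 hq hx.2) (hD0 x hx.1)
    obtain ⟨c, hc, hc'⟩ := exists_hasDerivAt_eq_slope Ψ D (half_lt_self hq)
      (fun x hx => (hD x (by have := hx.1; linarith)).continuousAt.continuousWithinAt)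
      (fun x hx => hD x (by have := hx.1; linarith))
    rw [hDz c ⟨by have := hc.1; linarith, hc.2.le⟩] at hc'
    have h2 : Ψ q = Ψ (q / 2) := by
      have : q - q / 2 ≠ 0 := by linarith
      field_simp at hc'
      linarith
    have h3 := hinvΦ q hq
    rw [h2, hinvΦ _ (half_pos hq)] at h3
    linarith
  -- derivative of the inverse
  have hΦd : ∀ q > (0:ℝ), HasDerivAt Φ (D (Φ q))⁻¹ q := by
    intro q hq
    have hp := hΦpos q hq
    have hs : HasStrictDerivAt Ψ (D (Φ q)) (Φ q) := by
      refine hasStrictDerivAt_of_hasDerivAt_of_continuousAt ?_ (hE _ hp).continuousAt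
      filter_upwards [Ioi_mem_nhds hp] with x hx using hD x hx
    have := (hs.to_local_left_inverse (hDpos _ hp).ne' (g := Φ) (by
      filter_upwards [Ioi_mem_nhds hp] with x hx using hinvΦ x hx)).hasDerivAt
    rwa [hΦinv q hq] at this
  have hDΦ : ∀ q > (0:ℝ), HasDerivAt (fun q => D (Φ q)) (E (Φ q) * (D (Φ q))⁻¹) q :=
    fun q hq => (hE _ (hΦpos q hq)).comp q (hΦd q hq)
  -- the derivative of the inverse is completely monotone
  have hgcm : ∀ n, CMn n (fun q => (D (Φ q))⁻¹) := by
    intro n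
    induction n with
    | zero => exact fun q hq => inv_nonneg.2 (hD0 _ (hΦpos q hq))
    | succ n ih =>
      refine ⟨fun q hq => inv_nonneg.2 (hD0 _ (hΦpos q hq)), _,
        (((CMn.comp hΦpos hΦd ih (hcm (n + 1))).pred.mul ih).mul (ih.mul ih)), fun q hq => ?_⟩
      have hne := (hDpos _ (hΦpos q hq)).ne'
      refine HasDerivAt.congr_deriv ((hDΦ q hq).inv hne) ?_
      field_simp
  have hEΦ : ∀ n, CMn n (fun q => E (Φ q)) := fun n =>
    (CMn.comp hΦpos hΦd (hgcm n) (hcm (n + 1))).pred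
  have heq : ∀ q > (0:ℝ), 1 / deriv Φ q = D (Φ q) := fun q hq => by
    rw [(hΦd q hq).deriv, one_div, inv_inv]
  have hd1 : ∀ q > (0:ℝ), HasDerivAt (fun q => 1 / deriv Φ q) (E (Φ q) * (D (Φ q))⁻¹) q := by
    intro q hq
    refine (hDΦ q hq).congr_of_eventuallyEq ?_
    filter_upwards [Ioi_mem_nhds hq] with p hp using heq p hp
  refine ⟨isBernstein_of_CMn (fun q hq => ?_) hd1 fun n => (hEΦ n).mul (hgcm n),
    isBernstein_of_CMn (h := fun q => 2 * E (Φ q)) (fun q hq => sq_nonneg _) (fun q hq => ?_)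
      fun n => (CMn.const n zero_le_two).mul (hEΦ n)⟩
  · rw [heq q hq]
    exact hD0 _ (hΦpos q hq)
  · have hne := (hDpos _ (hΦpos q hq)).ne'
    refine HasDerivAt.congr_deriv ((hd1 q hq).pow 2) ?_
    rw [heq q hq]
    field_simp
    simp; ring
end
end
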